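/- Let Γ = KQ'/I' be a basic finite-dimensional algebra and suppose there is a poset isomorphism ρ: sτtilt Λ → sτtilt Γ, with induced bijection σ: Q_0 → Q'_0. Then σ extends to a quiver isomorphism Q* ≅ (Q')*. -/

import Mathlib

/-!
Common framework for formalizing statements from
"From support τ-tilting posets to algebras" (R. Kase).

Modules over the basic finite dimensional algebra `Λ` are taken to be *right*
modules, encoded as (left) modules over the opposite ring `Λᵐᵒᵖ`.
τ-rigidity is encoded through the Auslander–Smalø criterion:
`Hom(M, τM) = 0` iff `Ext¹(M, Fac M) = 0`, and the vanishing of `Ext¹(M, X)`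
is encoded by the splitting of all short exact sequences `0 → X → E → M → 0`.
-/

open MulOpposite

namespace TauTilting

/-- Bundled modules over `A` (in `Type 0`). -/
abbrev Mdl (A : Type) [Ring A] := ModuleCat.{0} A

variable {A B : Type} [Ring A] [Ring B]

/-- `X ∈ Fac M` : `X` is a factor of a finite direct sum of copies of `M`. -/
def MemFac (M X : Mdl A) : Prop :=
  ∃ (n : ℕ) (f : (Fin n → M) →ₗ[A] X), Function.Surjective f

/-- Every short exact sequence `0 → X → E → M → 0` splits, i.e. `Ext¹(M, X) = 0`. -/
def Ext1Vanish (M X : Mdl A) : Prop :=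
  ∀ (E : Mdl A) (f : X →ₗ[A] E) (g : E →ₗ[A] M),
    Function.Injective f → Function.Surjective g →
    LinearMap.range f = LinearMap.ker g →
    ∃ s : M →ₗ[A] E, g.comp s = LinearMap.id

/-- `M` is τ-rigid (Auslander–Smalø: `Hom(M, τM) = 0 ↔ Ext¹(M, Fac M) = 0`). -/
def IsTauRigid (M : Mdl A) : Prop :=
  Module.Finite A M ∧ ∀ X : Mdl A, MemFac M X → Ext1Vanish M X

/-- `M` is indecomposable. -/
def IsIndec (M : Mdl A) : Prop :=
  Nontrivial M ∧ ∀ N N' : Submodule A M, IsCompl N N' → N = ⊥ ∨ N' = ⊥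

/-- `F` is an (internal) decomposition of `M` into indecomposable direct summands. -/
def IsDecompOf (M : Mdl A) {n : ℕ} (F : Fin n → Submodule A M) : Prop :=
  iSupIndep F ∧ iSup F = ⊤ ∧ ∀ k, IsIndec (ModuleCat.of A (F k))

/-- `|M| = n` : `M` decomposes into `n` indecomposable direct summands. -/
def HasNumSummands (M : Mdl A) (n : ℕ) : Prop :=
  ∃ F : Fin n → Submodule A M, IsDecompOf M F

/-- `M` is basic: its indecomposable direct summands are pairwise non-isomorphic. -/
def IsBasicMod (M : Mdl A) : Prop :=
  ∃ (n : ℕ) (F : Fin n → Submodule A M), IsDecompOf M F ∧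
    ∀ k l : Fin n, k ≠ l → IsEmpty (↥(F k) ≃ₗ[A] ↥(F l))

def ModIso (M N : Mdl A) : Prop := Nonempty (M ≃ₗ[A] N)

/-- The order on support τ-tilting modules: `M ≤ N ↔ Fac M ⊆ Fac N`. -/
def FacLE (M N : Mdl A) : Prop := ∀ X : Mdl A, MemFac M X → MemFac N X
def FacLT (M N : Mdl A) : Prop := FacLE M N ∧ ¬ FacLE N M
/-- Equality in the poset of iso-classes: mutual `≤`. -/
def PE (M N : Mdl A) : Prop := FacLE M N ∧ FacLE N M

/-- `N` is a direct summand of `M`. -/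
def IsSummand (N M : Mdl A) : Prop :=
  ∃ (f : N →ₗ[A] M) (g : M →ₗ[A] N), g.comp f = LinearMap.id
/-- `N ∈ add M`. -/
def InAdd (N M : Mdl A) : Prop := ∃ n : ℕ, IsSummand N (ModuleCat.of A (Fin n → M))
def HomZero (R M : Mdl A) : Prop := ∀ f : R →ₗ[A] M, f = 0

/-- Direct sum of two bundled modules. -/
def dsum (M N : Mdl A) : Mdl A := ModuleCat.of A (M × N)

/-- Hasse-quiver arrow `M → N` (so `N` is a direct successor of `M`, and `M` a
direct predecessor of `N`) in the poset of all modules satisfying `P`,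
ordered by `FacLE`. -/
def HArrow (P : Mdl A → Prop) (M N : Mdl A) : Prop :=
  P M ∧ P N ∧ FacLT N M ∧ ∀ C, P C → FacLT N C → FacLT C M → False

def IsMaxOf (P : Mdl A → Prop) (T : Mdl A) : Prop := P T ∧ ∀ S, P S → FacLE S T
def IsMinOf (P : Mdl A → Prop) (T : Mdl A) : Prop := P T ∧ ∀ S, P S → FacLE T S

/-- `T` has exactly `n` direct successors (counted up to poset equality). -/
def SuccsCard (P : Mdl A → Prop) (T : Mdl A) (n : ℕ) : Prop :=
  ∃ g : Fin n → Mdl A, (∀ k, HArrow P T (g k)) ∧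
    (∀ k l, k ≠ l → ¬ PE (g k) (g l)) ∧ ∀ S, HArrow P T S → ∃ k, PE S (g k)

/-- `T` has exactly `n` direct predecessors (counted up to poset equality). -/
def PredsCard (P : Mdl A → Prop) (T : Mdl A) (n : ℕ) : Prop :=
  ∃ g : Fin n → Mdl A, (∀ k, HArrow P (g k) T) ∧
    (∀ k l, k ≠ l → ¬ PE (g k) (g l)) ∧ ∀ S, HArrow P S T → ∃ k, PE S (g k)

/-- The poset of modules satisfying `P` (ordered by `FacLE`) is a lattice. -/
def IsLatticeP (P : Mdl A → Prop) : Prop :=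
  ∀ M N, P M → P N →
    (∃ J, P J ∧ FacLE M J ∧ FacLE N J ∧ ∀ C, P C → FacLE M C → FacLE N C → FacLE J C) ∧
    (∃ W, P W ∧ FacLE W M ∧ FacLE W N ∧ ∀ C, P C → FacLE C M → FacLE C N → FacLE C W)

/-- A poset isomorphism between the posets (of isomorphism classes) of modules
satisfying `PA` resp. `PB`, ordered by `FacLE`. -/
structure PosetIsoP (PA : Mdl A → Prop) (PB : Mdl B → Prop) where
  toFun : Mdl A → Mdl B
  invFun : Mdl B → Mdl A
  maps : ∀ M, PA M → PB (toFun M)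
  maps' : ∀ N, PB N → PA (invFun N)
  le_iff : ∀ M N, PA M → PA N → (FacLE M N ↔ FacLE (toFun M) (toFun N))
  le_iff' : ∀ M N, PB M → PB N → (FacLE M N ↔ FacLE (invFun M) (invFun N))
  left_inv : ∀ M, PA M → PE (invFun (toFun M)) M
  right_inv : ∀ N, PB N → PE (toFun (invFun N)) N

/-- A poset isomorphism between the poset of modules satisfying `P` and an
abstract poset `(β, le)`. -/
structure PosetIsoTo (P : Mdl A → Prop) (β : Type) (le : β → β → Prop) where
  toFun : Mdl A → β
  invFun : β → Mdl A
  maps' : ∀ b, P (invFun b)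
  le_iff : ∀ M N, P M → P N → (FacLE M N ↔ le (toFun M) (toFun N))
  left_inv : ∀ M, P M → PE (invFun (toFun M)) M
  right_inv : ∀ b, toFun (invFun b) = b

/-! ### Ring-level notions -/

variable (Λ : Type) [Ring Λ]

/-- The right ideal generated by a subset, as a right module (i.e. `Λᵐᵒᵖ`-module). -/
def rSpan (S : Set Λ) : Submodule Λᵐᵒᵖ Λ := Submodule.span Λᵐᵒᵖ S
/-- The two-sided ideal `(q) = ΛqΛ`, as a right `Λ`-module. -/
def tIdeal (q : Λ) : Submodule Λᵐᵒᵖ Λ := Submodule.span Λᵐᵒᵖ {y : Λ | ∃ a : Λ, y = a * q}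
/-- The right `Λ`-module `Λ/S`. -/
def quotMod (S : Submodule Λᵐᵒᵖ Λ) : Mdl Λᵐᵒᵖ := ModuleCat.of Λᵐᵒᵖ (Λ ⧸ S)
/-- `Λ` as a right module over itself. -/
def regMod : Mdl Λᵐᵒᵖ := ModuleCat.of Λᵐᵒᵖ Λ
/-- The projective right module `xΛ ≅ Λ/(1-x)Λ` attached to an idempotent `x`. -/
def projMod (x : Λ) : Mdl Λᵐᵒᵖ := quotMod Λ (rSpan Λ {1 - x})
/-- The right `Λ`-module `Λ/(1-x)`; for `x = e i` this is the module `X_i`. -/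
def cyclicQuot (x : Λ) : Mdl Λᵐᵒᵖ := quotMod Λ (tIdeal Λ (1 - x))

/-- `x` is a primitive idempotent. -/
def IsPrimIdem (x : Λ) : Prop :=
  IsIdempotentElem x ∧ x ≠ 0 ∧
    ∀ a b : Λ, IsIdempotentElem a → IsIdempotentElem b →
      a * b = 0 → b * a = 0 → a + b = x → a = 0 ∨ b = 0

variable {ι : Type} [Fintype ι]

/-- `e` is a complete family of orthogonal primitive idempotents of `Λ`. -/
def CompletePrimIdems (e : ι → Λ) : Prop :=
  (∀ i, IsPrimIdem Λ (e i)) ∧ (Pairwise fun i j => e i * e j = 0) ∧ ∑ i, e i = 1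

/-- `Λ` is basic w.r.t. `e`: the `e i Λ` are pairwise non-isomorphic. -/
def IsBasicAlg (e : ι → Λ) : Prop :=
  ∀ i j : ι, i ≠ j → IsEmpty (↥(projMod Λ (e i)) ≃ₗ[Λᵐᵒᵖ] ↥(projMod Λ (e j)))

/-- The support `supp(M) = {i | M·eᵢ ≠ 0}` of a right module `M`. -/
def Supp (e : ι → Λ) (M : Mdl Λᵐᵒᵖ) : Set ι := {i | ∃ m : M, op (e i) • m ≠ 0}

/-- Support τ-tilting module: τ-rigid with `|M| = #supp(M)`. -/
def IsSTT (e : ι → Λ) (M : Mdl Λᵐᵒᵖ) : Prop :=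
  Module.Finite Λᵐᵒᵖ M ∧ IsTauRigid M ∧ HasNumSummands M (Supp Λ e M).ncard

/-- Basic support τ-tilting module. -/
def IsBSTT (e : ι → Λ) (M : Mdl Λᵐᵒᵖ) : Prop := IsSTT Λ e M ∧ IsBasicMod M

/-- τ-tilting module: τ-rigid with `|M| = #Q₀`. -/
def IsTauTiltingMod (e : ι → Λ) (M : Mdl Λᵐᵒᵖ) : Prop :=
  IsSTT Λ e M ∧ HasNumSummands M (Fintype.card ι)

open scoped Classical in
/-- The idempotent `1 - e_M = Σ_{i ∉ supp M} e i`. -/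
noncomputable def cIdem (e : ι → Λ) (M : Mdl Λᵐᵒᵖ) : Λ :=
  ∑ i : ι, if i ∈ Supp Λ e M then 0 else e i

/-- τ-rigid pair `(M, P)`. -/
def IsTauRigidPair (e : ι → Λ) (M P : Mdl Λᵐᵒᵖ) : Prop :=
  IsTauRigid M ∧ Module.Finite Λᵐᵒᵖ P ∧ Module.Projective Λᵐᵒᵖ P ∧
    InAdd P (projMod Λ (cIdem Λ e M))

/-- Basic τ-rigid pair. -/
def IsBasicTRP (e : ι → Λ) (M P : Mdl Λᵐᵒᵖ) : Prop :=
  IsTauRigidPair Λ e M P ∧ IsBasicMod M ∧ IsBasicMod P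

/-- `T ∈ sτtilt_{(N,R)} Λ`, i.e. `N ∈ add T` and `Hom(R, T) = 0`. -/
def InPairSet (N R T : Mdl Λᵐᵒᵖ) : Prop := InAdd N T ∧ HomZero R T

/-- `Λ` is τ-tilting finite: finitely many basic support τ-tilting modules up to iso. -/
def TauTiltingFinite (e : ι → Λ) : Prop :=
  ∃ (n : ℕ) (T : Fin n → Mdl Λᵐᵒᵖ), ∀ M, IsBSTT Λ e M → ∃ k, ModIso M (T k)

/-- The Jacobson radical of `Λ`, as a `K`-subspace. -/
noncomputable def radK (K : Type) [CommRing K] (Λ : Type) [Ring Λ] [Algebra K Λ] :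
    Submodule K Λ :=
  Submodule.restrictScalars K (sInf {I : Ideal Λ | I.IsMaximal})

/-- Powers of the radical, with `rad⁰ = Λ`. -/
noncomputable def radPow (K : Type) [CommRing K] (Λ : Type) [Ring Λ] [Algebra K Λ] :
    ℕ → Submodule K Λ
  | 0 => ⊤
  | n + 1 => radK K Λ ^ (n + 1)

/-! ### Quivers, paths and presentations -/

/-- Paths in a quiver with vertex set `ι` and arrow types `Arr i j`. -/
inductive QPath {ι : Type} (Arr : ι → ι → Type) : ι → ι → Type
  | nil (i : ι) : QPath Arr i i
  | cons {i j k : ι} (a : Arr i j) (p : QPath Arr j k) : QPath Arr i k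

namespace QPath

variable {ι : Type} {Arr : ι → ι → Type}

/-- The list of visited vertices. -/
def verts : ∀ {i j : ι}, QPath Arr i j → List ι
  | i, _, .nil _ => [i]
  | i, _, .cons _ p => i :: p.verts

/-- Evaluation of a path in the algebra `Λ` (trivial path at `i` ↦ `e i`). -/
def eval {Λ : Type} [Ring Λ] (e : ι → Λ) (arr : ∀ i j, Arr i j → Λ) :
    ∀ {i j : ι}, QPath Arr i j → Λ
  | _, _, .nil i => e i
  | _, _, .cons a p => arr _ _ a * p.eval e arr

def append : ∀ {i j k : ι}, QPath Arr i j → QPath Arr j k → QPath Arr i k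
  | _, _, _, .nil _, q => q
  | _, _, _, .cons a p, q => .cons a (p.append q)

def single {i j : ι} (a : Arr i j) : QPath Arr i j := .cons a (.nil j)

end QPath

/-- The condition `xΛe_j = e_iΛe_j = e_iΛx ≠ 0` on an element `x` of `e_iΛe_j`. -/
def Gcond (ei ej x : Λ) : Prop :=
  (Set.range fun b => x * b * ej) = (Set.range fun b => ei * b * ej) ∧
  (Set.range fun b => ei * b * x) = (Set.range fun b => ei * b * ej) ∧
  ∃ b, ei * b * ej ≠ 0

/-- `w ∈ G(Q, I)` : `w` contains no cycle as a subpath (equivalently, visits no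
vertex twice) and `wΛe_j = e_iΛe_j = e_iΛw ≠ 0`. -/
def GMem (e : ι → Λ) {Arr : ι → ι → Type} (arr : ∀ i j, Arr i j → Λ) {i j : ι}
    (w : QPath Arr i j) : Prop :=
  w.verts.Nodup ∧ Gcond Λ (e i) (e j) (w.eval e arr)

/-- Condition 1 for a bound quiver: if `e_iΛe_j ≠ 0` then `G^i_j ≠ ∅`. -/
def Cond1 (e : ι → Λ) {Arr : ι → ι → Type} (arr : ∀ i j, Arr i j → Λ) : Prop :=
  ∀ i j : ι, (∃ x, e i * x * e j ≠ 0) → ∃ w : QPath Arr i j, GMem Λ e arr w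

/-- Ring-level version of Condition 1 (Lemma `eqcd` (iii)). -/
def Cond1R : Prop :=
  ∀ x y : Λ, IsPrimIdem Λ x → IsPrimIdem Λ y → x * y = 0 → y * x = 0 →
    ∃ w : Λ, (∃ b, w = x * b * y) ∧
      (Set.range fun b => w * b * y) = (Set.range fun b => x * b * y) ∧
      (Set.range fun b => x * b * w) = (Set.range fun b => x * b * y)

/-- `(e, Arr, arr)` presents `Λ` as the bound quiver algebra `KQ/I` with `Q` its
Gabriel quiver: `e` is a complete family of orthogonal primitive idempotents,
`Λ` is basic, each arrow `a : i → j` is sent to an element of `e_i (rad Λ) e_j`,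
and the arrows form a `K`-basis of `rad Λ / rad² Λ`. -/
def IsGabrielPres (K : Type) [Field K] [Algebra K Λ] [DecidableEq ι] (e : ι → Λ)
    (Arr : ι → ι → Type) [∀ i j, Fintype (Arr i j)] (arr : ∀ i j, Arr i j → Λ) : Prop :=
  CompletePrimIdems Λ e ∧ IsBasicAlg Λ e ∧
  (∀ i j (a : Arr i j), arr i j a ∈ radK K Λ ∧ e i * arr i j a * e j = arr i j a) ∧
  (radK K Λ ≤
    Submodule.span K (Set.range fun p : Σ i : ι, Σ j : ι, Arr i j => arr p.1 p.2.1 p.2.2) ⊔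
      radK K Λ * radK K Λ) ∧
  (∀ c : (Σ i : ι, Σ j : ι, Arr i j) → K,
    (∑ p : Σ i : ι, Σ j : ι, Arr i j, c p • arr p.1 p.2.1 p.2.2) ∈ radK K Λ * radK K Λ →
    ∀ p, c p = 0)

/-! ### Partitions of a quiver, Condition 2 -/

/-- `x` and `y` are adjacent within the vertex subset `S` (undirected). -/
def AdjIn {ι : Type} (Arr : ι → ι → Type) (S : Set ι) (x y : ι) : Prop :=
  x ∈ S ∧ y ∈ S ∧ (Nonempty (Arr x y) ∨ Nonempty (Arr y x))

/-- The full subquiver on `S` is connected. -/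
def ConnectedOn {ι : Type} (Arr : ι → ι → Type) (S : Set ι) : Prop :=
  ∀ x ∈ S, ∀ y ∈ S, Relation.ReflTransGen (AdjIn Arr S) x y

/-- Adjacency of parts in the quotient quiver `Q^μ`. -/
def PartAdj {ι : Type} (Arr : ι → ι → Type) {ℓ : ℕ} (μ : ι → Fin ℓ) (u v : Fin ℓ) : Prop :=
  u ≠ v ∧ ∃ x y, μ x = u ∧ μ y = v ∧ (Nonempty (Arr x y) ∨ Nonempty (Arr y x))

/-- Condition 2: there is a partition `μ` of `Q₀` into connected full subquivers
such that `Q^μ` is a tree (connected with `#arrows = #parts - 1`) and each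
`sτtilt Λ^{a,b}_μ` — identified with the subposet of `sτtilt Λ` of modules
supported on the union of the two parts — is a lattice. -/
def Cond2 (e : ι → Λ) (Arr : ι → ι → Type) [∀ i j, Fintype (Arr i j)] : Prop :=
  ∃ (ℓ : ℕ) (μ : ι → Fin ℓ), Function.Surjective μ ∧
    (∀ a : Fin ℓ, ConnectedOn Arr {i | μ i = a}) ∧
    (∀ u v : Fin ℓ, Relation.ReflTransGen (PartAdj Arr μ) u v) ∧
    Nat.card {p : Σ i : ι, Σ j : ι, Arr i j // μ p.1 ≠ μ p.2.1} = ℓ - 1 ∧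
    ∀ a b : Fin ℓ, a ≠ b →
      IsLatticeP (fun T : Mdl Λᵐᵒᵖ => IsBSTT Λ e T ∧ Supp Λ e T ⊆ {i | μ i = a ∨ μ i = b})

/-! ### Correspondence of paths under a quiver isomorphism, and `∼` -/

/-- Transport of paths along a quiver isomorphism `σ : Q° → (Q')°` (defined on
non-loop arrows). -/
inductive PathCorr {ι ι' : Type} {Arr : ι → ι → Type} {Arr' : ι' → ι' → Type}
    (σ : ι → ι') (σ1 : ∀ i j, i ≠ j → Arr i j → Arr' (σ i) (σ j)) :
    ∀ {i j : ι}, QPath Arr i j → QPath Arr' (σ i) (σ j) → Prop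
  | nil (i : ι) : PathCorr σ σ1 (QPath.nil i) (QPath.nil (σ i))
  | cons {i j k : ι} (h : i ≠ j) (a : Arr i j) {p : QPath Arr j k}
      {p' : QPath Arr' (σ j) (σ k)} :
      PathCorr σ σ1 p p' → PathCorr σ σ1 (QPath.cons a p) (QPath.cons (σ1 i j h a) p')

/-- The relation `(Q, I) ∼ (Q', I')`: there is a quiver isomorphism
`σ : Q° → (Q')°` with (a) `supp(e_{σ(i)}Γ) = σ(supp(e_iΛ))` and (b) `G(Γ) = σ(G(Λ))`. -/
def SimCond {Λ Γ : Type} [Ring Λ] [Ring Γ] {ι ι' : Type}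
    (e : ι → Λ) {Arr : ι → ι → Type} (arr : ∀ i j, Arr i j → Λ)
    (f : ι' → Γ) {Arr' : ι' → ι' → Type} (arr' : ∀ i j, Arr' i j → Γ) : Prop :=
  ∃ (σ : ι ≃ ι') (σ1 : ∀ i j, i ≠ j → (Arr i j ≃ Arr' (σ i) (σ j))),
    (∀ i j : ι, (∃ x, e i * x * e j ≠ 0) ↔ ∃ y, f (σ i) * y * f (σ j) ≠ 0) ∧
    (∀ (i j : ι) (w : QPath Arr i j), GMem Λ e arr w →
      ∃ w' : QPath Arr' (σ i) (σ j),
        PathCorr σ (fun i j h => σ1 i j h) w w' ∧ GMem Γ f arr' w') ∧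
    (∀ (i j : ι) (w' : QPath Arr' (σ i) (σ j)), GMem Γ f arr' w' →
      ∃ w : QPath Arr i j,
        PathCorr σ (fun i j h => σ1 i j h) w w' ∧ GMem Λ e arr w)

end TauTilting

namespace TauTilting

section Fac

variable {R : Type} [Ring R]

theorem memFac_of_fintype {κ : Type} [Fintype κ] {M X : Mdl R} (f : (κ → M) →ₗ[R] X)
    (hf : Function.Surjective f) : MemFac M X :=
  ⟨Fintype.card κ, f ∘ₗ (LinearEquiv.funCongrLeft R M (Fintype.equivFin κ)).toLinearMap,
    hf.comp (LinearEquiv.surjective _)⟩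

theorem MemFac.of_surjective {M X Z : Mdl R} (h : MemFac M X) (g : X →ₗ[R] Z)
    (hg : Function.Surjective g) : MemFac M Z := by
  obtain ⟨n, f, hf⟩ := h
  exact ⟨n, g ∘ₗ f, hg.comp hf⟩

theorem memFac_self (M : Mdl R) : MemFac M M :=
  ⟨1, LinearMap.proj 0, fun m => ⟨fun _ => m, rfl⟩⟩

theorem MemFac.trans {M X Z : Mdl R} (h : MemFac M X) (h' : MemFac X Z) : MemFac M Z := by
  obtain ⟨m, f, hf⟩ := h
  obtain ⟨n, g, hg⟩ := h'
  refine memFac_of_fintype (κ := Fin n × Fin m)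
    (g ∘ₗ f.compLeft (Fin n) ∘ₗ (LinearEquiv.curry R M (Fin n) (Fin m)).toLinearMap) ?_
  exact hg.comp ((Function.Surjective.comp_left hf).comp (LinearEquiv.surjective _))

theorem memFac_of_subsingleton (M X : Mdl R) [Subsingleton X] : MemFac M X :=
  ⟨0, 0, fun _ => ⟨0, Subsingleton.elim _ _⟩⟩

theorem facLE_iff {M N : Mdl R} : FacLE M N ↔ MemFac N M :=
  ⟨fun h => h M (memFac_self M), fun h _ hX => h.trans hX⟩

theorem FacLE.trans {L M N : Mdl R} (h : FacLE L M) (h' : FacLE M N) : FacLE L N :=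
  fun X hX => h' X (h X hX)

theorem MemFac.smul_eq_zero {M X : Mdl R} (h : MemFac M X) {r : R} (hr : ∀ m : M, r • m = 0)
    (x : X) : r • x = 0 := by
  obtain ⟨n, f, hf⟩ := h
  obtain ⟨v, rfl⟩ := hf x
  have : r • v = 0 := funext fun k => hr (v k)
  rw [← map_smul, this, map_zero]

theorem MemFac.prod {M X Y : Mdl R} (hX : MemFac M X) (hY : MemFac M Y) :
    MemFac M (dsum X Y) := by
  obtain ⟨m, f, hf⟩ := hX
  obtain ⟨n, g, hg⟩ := hY
  refine memFac_of_fintype (κ := Fin m ⊕ Fin n) (X := dsum X Y)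
    ((f.prodMap g) ∘ₗ (LinearEquiv.sumArrowLequivProdArrow (Fin m) (Fin n) R M).toLinearMap) ?_
  exact (Function.Surjective.prodMap hf hg).comp (LinearEquiv.surjective _)

theorem Ext1Vanish.exists_lift {M X : Mdl R} (h : Ext1Vanish M X) {E G : Type}
    [AddCommGroup E] [Module R E] [AddCommGroup G] [Module R G]
    (f : X →ₗ[R] E) (p : E →ₗ[R] G) (hf : Function.Injective f) (hp : Function.Surjective p)
    (hfp : LinearMap.range f = LinearMap.ker p) (g : M →ₗ[R] G) :
    ∃ s : M →ₗ[R] E, p ∘ₗ s = g := by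
  let E' : Submodule R (E × M) := LinearMap.eqLocus (p ∘ₗ LinearMap.fst R E M)
    (g ∘ₗ LinearMap.snd R E M)
  have hpf : ∀ x, p (f x) = 0 := fun x => by
    have : f x ∈ LinearMap.ker p := hfp ▸ ⟨x, rfl⟩
    exact this
  let f' : X →ₗ[R] E' := LinearMap.codRestrict E' (LinearMap.inl R E M ∘ₗ f) (fun x => by
    simp [E', LinearMap.mem_eqLocus, hpf])
  let g' : E' →ₗ[R] M := LinearMap.snd R E M ∘ₗ E'.subtype
  obtain ⟨s, hs⟩ := h (ModuleCat.of R E') f' g' (fun x y hxy => hf (by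
      have := congrArg (fun z : E' => z.1.1) hxy
      exact this))
    (fun m => by
      obtain ⟨x, hx⟩ := hp (g m)
      exact ⟨⟨(x, m), hx⟩, rfl⟩)
    (by
      ext ⟨⟨x, m⟩, hxm⟩
      constructor
      · rintro ⟨y, hy⟩
        have := congrArg (fun z : E' => z.1.2) hy
        exact this.symm
      · intro hm
        have hm : m = 0 := hm
        subst hm
        have hx : p x = g 0 := hxm
        rw [map_zero] at hx
        obtain ⟨y, rfl⟩ : x ∈ LinearMap.range f := hfp ▸ hx
        exact ⟨y, rfl⟩)
  refine ⟨LinearMap.fst R E M ∘ₗ E'.subtype ∘ₗ s, ?_⟩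
  ext m
  have h1 : p (s m).1.1 = g (s m).1.2 := (s m).2
  have h2 : (s m).1.2 = m := LinearMap.congr_fun hs m
  rw [h2] at h1
  exact h1

theorem Ext1Vanish.prod {M N X : Mdl R} (hM : Ext1Vanish M X) (hN : Ext1Vanish N X) :
    Ext1Vanish (dsum M N) X := by
  intro E f g hf hg hfg
  obtain ⟨s, hs⟩ := hM.exists_lift (G := M × N) f g hf hg hfg (LinearMap.inl R M N)
  obtain ⟨t, ht⟩ := hN.exists_lift (G := M × N) f g hf hg hfg (LinearMap.inr R M N)
  refine ⟨LinearMap.coprod s t, ?_⟩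
  have : g ∘ₗ LinearMap.coprod s t = LinearMap.id (R := R) (M := M × N) := by
    rw [LinearMap.comp_coprod]
    erw [hs, ht]
    exact LinearMap.coprod_inl_inr
  exact this

theorem IsTauRigid.memFac_of_quotient {T : Mdl R} (hT : IsTauRigid T) {M : Type}
    [AddCommGroup M] [Module R M] (N : Submodule R M) (hN : MemFac T (ModuleCat.of R N))
    (hMN : MemFac T (ModuleCat.of R (M ⧸ N))) : MemFac T (ModuleCat.of R M) := by
  obtain ⟨m, f, hf⟩ := hN
  have hN' : MemFac T (ModuleCat.of R N) := ⟨m, f, hf⟩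
  obtain ⟨n, g, hg⟩ := hMN
  have hlift : ∀ k : Fin n, ∃ s : T →ₗ[R] M,
      N.mkQ ∘ₗ s = g ∘ₗ LinearMap.single R (fun _ : Fin n => (T : Type)) k := fun k =>
    (hT.2 _ hN').exists_lift (X := ModuleCat.of R N) N.subtype N.mkQ
      N.injective_subtype N.mkQ_surjective (by simp) _
  choose s hs using hlift
  let φ : (Fin n → T) →ₗ[R] M := LinearMap.lsum R (fun _ : Fin n => (T : Type)) ℕ s
  have hφ : N.mkQ ∘ₗ φ = g := by
    apply LinearMap.pi_ext
    intro k t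
    have := LinearMap.congr_fun (hs k) t
    simp only [LinearMap.comp_apply, LinearMap.single_apply] at this
    rw [← this]
    simp only [LinearMap.comp_apply, φ]
    congr 1
    rw [LinearMap.lsum_apply, LinearMap.sum_apply, Finset.sum_eq_single k]
    · simp
    · intro b _ hb
      simp [hb]
    · simp
  refine memFac_of_fintype (κ := Fin m ⊕ Fin n) (X := ModuleCat.of R M)
    ((LinearMap.coprod (N.subtype ∘ₗ f) φ) ∘ₗ
      (LinearEquiv.sumArrowLequivProdArrow (Fin m) (Fin n) R T).toLinearMap) ?_
  have : Function.Surjective (LinearMap.coprod (N.subtype ∘ₗ f) φ) := by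
    intro x
    obtain ⟨v, hv⟩ := hg (N.mkQ x)
    rw [← hφ] at hv
    have hx : x - φ v ∈ N := by
      rw [← Submodule.ker_mkQ N, LinearMap.mem_ker, map_sub, sub_eq_zero]
      exact hv.symm
    obtain ⟨w, hw⟩ := hf ⟨x - φ v, hx⟩
    refine ⟨(w, v), ?_⟩
    rw [LinearMap.coprod_apply, LinearMap.comp_apply]
    erw [hw]
    simp
  exact this.comp (LinearEquiv.surjective _)

end Fac

/-- A complete family of orthogonal idempotents with local, pairwise non-isomorphic corners. -/
structure BasicIdems {R : Type} [Ring R] {ι : Type} [Fintype ι] (ε : ι → R) : Prop where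
  idem : ∀ i, ε i * ε i = ε i
  orth : ∀ i j, i ≠ j → ε i * ε j = 0
  sum_eq_one : ∑ i, ε i = 1
  ne_zero : ∀ i, ε i ≠ 0
  isNilpotent_or : ∀ i x, ε i * x = x → x * ε i = x → IsNilpotent x ∨ ∃ y, y * x = ε i
  isNilpotent_of_ne : ∀ i j, i ≠ j → ∀ x y, IsNilpotent (ε i * x * ε j * y * ε i)

/-- `T` generates a simple module supported at the vertex `i`. -/
def HasTop {R : Type} [Ring R] {ι : Type} (ε : ι → R) (T : Mdl R) (i : ι) : Prop :=
  ∃ S : Mdl R, IsSimpleModule R S ∧ MemFac T S ∧ ∃ s : S, s ≠ 0 ∧ ε i • s = s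

theorem exists_simple_quotient (R M : Type) [Ring R] [AddCommGroup M] [Module R M]
    [Module.Finite R M] [Nontrivial M] : ∃ N : Submodule R M, IsSimpleModule R (M ⧸ N) := by
  obtain ⟨N, hN, -⟩ := (eq_top_or_exists_le_coatom (⊥ : Submodule R M)).resolve_left bot_ne_top
  exact ⟨N, isSimpleModule_iff_isCoatom.2 hN⟩

theorem exists_smul_eq_of_ne_zero {R S : Type} [Ring R] [AddCommGroup S] [Module R S]
    [IsSimpleModule R S] {s : S} (hs : s ≠ 0) (t : S) : ∃ r : R, r • s = t :=
  IsSimpleModule.toSpanSingleton_surjective R hs t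

theorem pow_smul_of_smul_eq {R M : Type} [Ring R] [AddCommGroup M] [Module R M] {x : R} {m : M}
    (h : x • m = m) (n : ℕ) : x ^ n • m = m := by
  induction n with
  | zero => simp
  | succ n ih => rw [pow_succ, mul_smul, h, ih]

theorem eq_zero_of_isNilpotent_smul {R M : Type} [Ring R] [AddCommGroup M] [Module R M] {x : R}
    {m : M} (hx : IsNilpotent x) (h : x • m = m) : m = 0 := by
  obtain ⟨n, hn⟩ := hx
  rw [← pow_smul_of_smul_eq h n, hn, zero_smul]

namespace BasicIdems

variable {R : Type} [Ring R] {ι : Type} [Fintype ι] {ε : ι → R} (H : BasicIdems ε)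

include H

theorem smul_smul (i : ι) {M : Type} [AddCommGroup M] [Module R M] (m : M) :
    ε i • ε i • m = ε i • m := by
  rw [← mul_smul, H.idem]

theorem exists_smul_ne_zero {M : Type} [AddCommGroup M] [Module R M] {m : M} (hm : m ≠ 0) :
    ∃ i, ε i • m ≠ 0 := by
  by_contra! h
  apply hm
  rw [← one_smul R m, ← H.sum_eq_one, Finset.sum_smul, Finset.sum_eq_zero fun i _ => h i]

theorem smul_eq_zero_of_isNilpotent {S : Type} [AddCommGroup S] [Module R S]
    [IsSimpleModule R S] {i : ι} {x : R} (hx : IsNilpotent x) (h1 : ε i * x = x)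
    (h2 : x * ε i = x) {s : S} (hs : ε i • s = s) : x • s = 0 := by
  by_contra hne
  obtain ⟨b, hb⟩ := exists_smul_eq_of_ne_zero (R := R) hne s
  have hw : (ε i * b * x) • s = s := by
    rw [mul_smul, mul_smul, hb, hs]
  rcases H.isNilpotent_or i (ε i * b * x) (by simp only [← mul_assoc, H.idem])
    (by rw [mul_assoc, h2]) with hn | ⟨y, hy⟩
  · apply hne
    rw [eq_zero_of_isNilpotent_smul hn hw, smul_zero]
  · obtain ⟨n, hn⟩ := hx
    have key : ∀ n : ℕ, x ^ (n + 1) = 0 → x = 0 := by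
      intro n
      induction n with
      | zero => simp
      | succ n ih =>
        intro h
        apply ih
        have : (y * (ε i * b)) * x ^ (n + 1 + 1) = x ^ (n + 1) := by
          rw [pow_succ' x (n + 1), ← mul_assoc, mul_assoc y, hy, pow_succ', ← mul_assoc, h1]
        rw [← this, h, mul_zero]
    have : x = 0 := key n (by rw [pow_succ, hn, zero_mul])
    rw [this, zero_smul] at hne
    exact hne rfl

theorem smul_eq_zero_of_smul_eq_zero {S S' : Type} [AddCommGroup S] [Module R S]
    [AddCommGroup S'] [Module R S'] [IsSimpleModule R S'] {i : ι} {s : S}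
    (hs0 : s ≠ 0) (hs : ε i • s = s) {s' : S'} (hs' : ε i • s' = s') {a : R}
    (ha : a • s = 0) : a • s' = 0 := by
  by_contra hne
  obtain ⟨b, hb⟩ := exists_smul_eq_of_ne_zero (R := R) hne s'
  have h1 : (ε i * b * a * ε i) • s' = s' := by
    rw [mul_smul, hs', mul_smul, mul_smul, hb, hs']
  have h2 : (ε i * b * a * ε i) • s = 0 := by
    rw [mul_smul, hs, mul_smul, ha, smul_zero]
  rcases H.isNilpotent_or i (ε i * b * a * ε i) (by simp only [← mul_assoc, H.idem])
    (by simp only [mul_assoc, H.idem]) with hn | ⟨y, hy⟩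
  · apply hne
    rw [eq_zero_of_isNilpotent_smul hn h1, smul_zero]
  · apply hs0
    rw [← hs, ← hy, mul_smul, h2, smul_zero]

theorem exists_surjective_of_simple {S S' : Type} [AddCommGroup S] [Module R S]
    [AddCommGroup S'] [Module R S'] [IsSimpleModule R S] [IsSimpleModule R S'] {i : ι} {s : S}
    (hs0 : s ≠ 0) (hs : ε i • s = s) {s' : S'} (hs0' : s' ≠ 0) (hs' : ε i • s' = s') :
    ∃ f : S →ₗ[R] S', Function.Surjective f := by
  have hk : LinearMap.ker (LinearMap.toSpanSingleton R S s) ≤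
      LinearMap.ker (LinearMap.toSpanSingleton R S' s') := fun a ha =>
    H.smul_eq_zero_of_smul_eq_zero hs0 hs hs' ha
  let g := (LinearMap.quotKerEquivOfSurjective (LinearMap.toSpanSingleton R S s)
    (IsSimpleModule.toSpanSingleton_surjective R hs0)).symm
  refine ⟨Submodule.liftQ _ (LinearMap.toSpanSingleton R S' s') hk ∘ₗ g.toLinearMap, ?_⟩
  have hsurj : Function.Surjective
      (Submodule.liftQ _ (LinearMap.toSpanSingleton R S' s') hk) := by
    intro t
    obtain ⟨r, hr⟩ := exists_smul_eq_of_ne_zero (R := R) hs0' t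
    exact ⟨Submodule.Quotient.mk r, hr⟩
  exact hsurj.comp g.surjective

theorem smul_simple_eq_zero {S : Type} [AddCommGroup S] [Module R S]
    [IsSimpleModule R S] {i j : ι} (hij : i ≠ j) {s : S} (hs0 : s ≠ 0) (hs : ε i • s = s)
    (t : S) : ε j • t = 0 := by
  obtain ⟨a, rfl⟩ := exists_smul_eq_of_ne_zero (R := R) hs0 t
  by_contra hne
  obtain ⟨b, hb⟩ := exists_smul_eq_of_ne_zero (R := R) hne s
  have h1 : (ε i * b * ε j * a * ε i) • s = s := by
    rw [mul_smul, hs, mul_smul, mul_smul, mul_smul, hb, hs]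
  exact hs0 (eq_zero_of_isNilpotent_smul (H.isNilpotent_of_ne i j hij b a) h1)

theorem hasTop_of_nontrivial {T : Mdl R} {M : Type} [AddCommGroup M] [Module R M]
    [Module.Finite R M] [Nontrivial M] (hM : MemFac T (ModuleCat.of R M)) :
    ∃ i, HasTop ε T i ∧ ∃ m : M, ε i • m ≠ 0 := by
  obtain ⟨N, hN⟩ := exists_simple_quotient R M
  have := IsSimpleModule.nontrivial R (M ⧸ N)
  obtain ⟨x, hx⟩ := exists_ne (0 : M ⧸ N)
  obtain ⟨i, hi⟩ := H.exists_smul_ne_zero hx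
  refine ⟨i, ⟨ModuleCat.of R (M ⧸ N), hN, hM.of_surjective (Z := ModuleCat.of R (M ⧸ N)) N.mkQ
    N.mkQ_surjective, ε i • x, hi, H.smul_smul i x⟩, ?_⟩
  obtain ⟨m, rfl⟩ := N.mkQ_surjective x
  refine ⟨m, fun h => hi ?_⟩
  rw [← map_smul, h, map_zero]

theorem memFac_of_isFiniteLength {T : Mdl R} (hT : IsTauRigid T) {M : Type} [AddCommGroup M]
    [Module R M] (hM : IsFiniteLength R M)
    (htop : ∀ i, (∃ m : M, ε i • m ≠ 0) → HasTop ε T i) : MemFac T (ModuleCat.of R M) := by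
  induction hM with
  | of_subsingleton => exact memFac_of_subsingleton _ _
  | @of_simple_quotient M _ _ N hS _ ih =>
    refine hT.memFac_of_quotient N (ih fun i ⟨m, hm⟩ => htop i ⟨m, fun h => hm ?_⟩) ?_
    · exact Subtype.ext h
    · have := IsSimpleModule.nontrivial R (M ⧸ N)
      obtain ⟨x, hx⟩ := exists_ne (0 : M ⧸ N)
      obtain ⟨i, hi⟩ := H.exists_smul_ne_zero hx
      obtain ⟨S, hS', hTS, s, hs0, hs⟩ := htop i (by
        obtain ⟨m, rfl⟩ := N.mkQ_surjective x
        refine ⟨m, fun h => hi ?_⟩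
        rw [← map_smul, h, map_zero])
      obtain ⟨f, hf⟩ := H.exists_surjective_of_simple hs0 hs hi (H.smul_smul i x)
      exact hTS.of_surjective (Z := ModuleCat.of R (M ⧸ N)) f hf

theorem memFac_of_hasTop [IsArtinianRing R] {T : Mdl R} (hT : IsTauRigid T) {M : Type}
    [AddCommGroup M] [Module R M] [Module.Finite R M]
    (htop : ∀ i, (∃ m : M, ε i • m ≠ 0) → HasTop ε T i) : MemFac T (ModuleCat.of R M) :=
  H.memFac_of_isFiniteLength hT
    (isFiniteLength_iff_isNoetherian_isArtinian.2 ⟨inferInstance, inferInstance⟩) htop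

end BasicIdems

section Decomposition

variable {R : Type} [Ring R]

theorem isIndec_of_idempotent {M : Type} [AddCommGroup M] [Module R M] [Nontrivial M]
    (h : ∀ π : M →ₗ[R] M, (∀ m, π (π m) = π m) → π = 0 ∨ π = LinearMap.id) :
    IsIndec (ModuleCat.of R M) := by
  refine ⟨‹_›, fun (N N' : Submodule R M) hN => ?_⟩
  rcases h (N.projection N' hN) (fun m => by simp) with h0 | h1
  · left
    rw [eq_bot_iff]
    intro x hx
    have : N.projection N' hN x = x := Submodule.projection_apply_of_mem_left hN hx
    rw [h0] at this
    exact this.symm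
  · right
    rw [eq_bot_iff]
    intro x hx
    have : N.projection N' hN x = 0 := (Submodule.projection_apply_eq_zero_iff hN).2 hx
    rw [h1] at this
    exact this

theorem IsIndec.of_equiv {M N : Type} [AddCommGroup M] [Module R M] [AddCommGroup N] [Module R N]
    (h : IsIndec (ModuleCat.of R M)) (f : M ≃ₗ[R] N) : IsIndec (ModuleCat.of R N) := by
  refine ⟨@Equiv.nontrivial _ _ f.symm.toEquiv h.1, fun (A B : Submodule R N) hAB => ?_⟩
  have := h.2 ((Submodule.orderIsoMapComap f).symm A) ((Submodule.orderIsoMapComap f).symm B)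
    ((OrderIso.isCompl_iff _).1 hAB)
  rcases this with h | h
  · left
    exact (map_eq_bot_iff (Submodule.orderIsoMapComap f).symm).1 h
  · right
    exact (map_eq_bot_iff (Submodule.orderIsoMapComap f).symm).1 h

theorem hasNumSummands_zero (M : Type) [AddCommGroup M] [Module R M] [Subsingleton M] :
    HasNumSummands (ModuleCat.of R M) 0 ∧ IsBasicMod (ModuleCat.of R M) := by
  have : IsDecompOf (ModuleCat.of R M) (fun _ : Fin 0 => (⊥ : Submodule R M)) :=
    ⟨fun i => i.elim0, Subsingleton.elim _ _, fun k => k.elim0⟩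
  exact ⟨⟨_, this⟩, 0, _, this, fun k => k.elim0⟩

theorem hasNumSummands_one {M : Type} [AddCommGroup M] [Module R M]
    (hM : IsIndec (ModuleCat.of R M)) :
    HasNumSummands (ModuleCat.of R M) 1 ∧ IsBasicMod (ModuleCat.of R M) := by
  have : IsDecompOf (ModuleCat.of R M) (fun _ : Fin 1 => (⊤ : Submodule R M)) := by
    refine ⟨?_, by simp, fun _ => hM.of_equiv (Submodule.topEquiv (R := R) (M := M)).symm⟩
    intro i
    refine disjoint_bot_right.mono_right (iSup₂_le fun j hj => ?_)
    exact (hj (Subsingleton.elim _ _)).elim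
  exact ⟨⟨_, this⟩, 1, _, this, fun k l hkl => (hkl (Subsingleton.elim _ _)).elim⟩

theorem hasNumSummands_prod {M N : Type} [AddCommGroup M] [Module R M] [AddCommGroup N]
    [Module R N] (hM : IsIndec (ModuleCat.of R M)) (hN : IsIndec (ModuleCat.of R N))
    (hMN : IsEmpty (M ≃ₗ[R] N)) :
    HasNumSummands (ModuleCat.of R (M × N)) 2 ∧ IsBasicMod (ModuleCat.of R (M × N)) := by
  let A : Submodule R (M × N) := LinearMap.range (LinearMap.inl R M N)
  let B : Submodule R (M × N) := LinearMap.range (LinearMap.inr R M N)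
  have eA : M ≃ₗ[R] A := LinearEquiv.ofInjective _ LinearMap.inl_injective
  have eB : N ≃ₗ[R] B := LinearEquiv.ofInjective _ LinearMap.inr_injective
  have hAB : IsCompl A B := LinearMap.isCompl_range_inl_inr
  let F : Fin 2 → Submodule R (M × N) := ![A, B]
  have hF : IsDecompOf (ModuleCat.of R (M × N)) F := by
    refine ⟨?_, ?_, ?_⟩
    · exact (iSupIndep_pair (i := (0 : Fin 2)) (j := 1) (by decide)
        (fun k => by fin_cases k <;> simp)).2 hAB.disjoint
    · rw [eq_top_iff, ← hAB.sup_eq_top]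
      exact sup_le (le_iSup F 0) (le_iSup F 1)
    · intro k
      fin_cases k
      · exact hM.of_equiv eA
      · exact hN.of_equiv eB
  refine ⟨⟨F, hF⟩, 2, F, hF, ?_⟩
  intro k l hkl
  fin_cases k <;> fin_cases l
  · exact (hkl rfl).elim
  · exact ⟨fun g => hMN.false ((eA.trans g).trans eB.symm)⟩
  · exact ⟨fun g => hMN.false ((eA.trans g.symm).trans eB.symm)⟩
  · exact (hkl rfl).elim

end Decomposition

/-- `P` is generated by `u` and represents `M ↦ {m | ε • m = m}` on the modules killed by `q`. -/
structure IsRelProj {R : Type} [Ring R] (q ε : R) (P : Type) [AddCommGroup P] [Module R P]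
    (u : P) : Prop where
  smul_gen : ε • u = u
  smul_eq_zero : ∀ p : P, q • p = 0
  exists_smul : ∀ p : P, ∃ r : R, r • u = p
  exists_hom : ∀ (M : Type) [AddCommGroup M] [Module R M], (∀ m : M, q • m = 0) →
    ∀ m : M, ε • m = m → ∃ φ : P →ₗ[R] M, φ u = m

namespace IsRelProj

variable {R : Type} [Ring R] {q ε : R} {P : Type} [AddCommGroup P] [Module R P] {u : P}
  (hP : IsRelProj q ε P u)

include hP

theorem hom_ext {M : Type} [AddCommGroup M] [Module R M] {φ ψ : P →ₗ[R] M} (h : φ u = ψ u) :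
    φ = ψ := by
  ext p
  obtain ⟨r, rfl⟩ := hP.exists_smul p
  rw [map_smul, map_smul, h]

theorem finite : Module.Finite R P :=
  Module.Finite.of_surjective (LinearMap.toSpanSingleton R P u) hP.exists_smul

theorem exists_lift {M Z : Type} [AddCommGroup M] [Module R M] [AddCommGroup Z] [Module R Z]
    (hε : ε * ε = ε) (hM : ∀ m : M, q • m = 0) (g : M →ₗ[R] Z) (hg : Function.Surjective g)
    (φ : P →ₗ[R] Z) : ∃ ψ : P →ₗ[R] M, g ∘ₗ ψ = φ := by
  obtain ⟨m, hm⟩ := hg (φ u)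
  obtain ⟨ψ, hψ⟩ := hP.exists_hom M hM (ε • m) (by rw [smul_smul, hε])
  refine ⟨ψ, hP.hom_ext ?_⟩
  rw [LinearMap.comp_apply, hψ, map_smul, hm, ← map_smul, hP.smul_gen]

theorem ext1Vanish (hq : q * q = q) (hε : ε * ε = ε) {X : Mdl R} (hX : ∀ x : X, q • x = 0) :
    Ext1Vanish (ModuleCat.of R P) X := by
  intro E f g hf hg hfg
  have hE : ∀ m : E, q • m = 0 := by
    intro m
    have : q • m ∈ LinearMap.ker g := by
      rw [LinearMap.mem_ker, map_smul]
      exact hP.smul_eq_zero _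
    rw [← hfg] at this
    obtain ⟨x, hx⟩ := this
    rw [← hq, mul_smul, ← hx, ← map_smul, hX, map_zero]
  exact hP.exists_lift hε hE g hg LinearMap.id

theorem isTauRigid (hq : q * q = q) (hε : ε * ε = ε) : IsTauRigid (ModuleCat.of R P) :=
  ⟨hP.finite, fun _ hX => hP.ext1Vanish hq hε (hX.smul_eq_zero hP.smul_eq_zero)⟩

theorem exists_corner_smul (hε : ε * ε = ε) (φ : P →ₗ[R] P) :
    ∃ a : R, ε * a = a ∧ a * ε = a ∧ φ u = a • u := by
  obtain ⟨a, ha⟩ := hP.exists_smul (φ u)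
  refine ⟨ε * a * ε, by simp only [← mul_assoc, hε], by simp only [mul_assoc, hε], ?_⟩
  rw [mul_smul, hP.smul_gen, mul_smul, ha, ← map_smul, hP.smul_gen]

end IsRelProj

namespace BasicIdems

variable {R : Type} [Ring R] {ι : Type} [Fintype ι] {ε : ι → R} (H : BasicIdems ε)

include H

theorem exists_simple (i : ι) : ∃ S : Mdl R, IsSimpleModule R S ∧ ∃ s : S, s ≠ 0 ∧ ε i • s = s := by
  let M : Submodule R R := Submodule.span R {ε i}
  have hm : ε i ∈ M := Submodule.mem_span_singleton_self _
  have : Nontrivial M := ⟨⟨⟨ε i, hm⟩, 0, fun h => H.ne_zero i (congrArg Subtype.val h)⟩⟩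
  have : Module.Finite R M := Module.Finite.span_singleton R _
  obtain ⟨N, hN⟩ := exists_simple_quotient R M
  refine ⟨ModuleCat.of R (M ⧸ N), hN, N.mkQ ⟨ε i, hm⟩, ?_, ?_⟩
  · intro h0
    have := IsSimpleModule.nontrivial R (M ⧸ N)
    obtain ⟨x, hx⟩ := exists_ne (0 : M ⧸ N)
    obtain ⟨⟨y, hy⟩, rfl⟩ := N.mkQ_surjective x
    obtain ⟨r, rfl⟩ := Submodule.mem_span_singleton.1 hy
    apply hx
    have : (⟨r • ε i, hy⟩ : M) = r • ⟨ε i, hm⟩ := rfl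
    rw [this, map_smul]
    erw [h0]
    rw [smul_zero]
  · have : (⟨ε i, hm⟩ : M) = ε i • ⟨ε i, hm⟩ := Subtype.ext (H.idem i).symm
    conv_rhs => rw [this]
    rfl

theorem smul_simple_eq_self {S : Type} [AddCommGroup S] [Module R S]
    [IsSimpleModule R S] {i : ι} {s : S} (hs0 : s ≠ 0) (hs : ε i • s = s)
    (t : S) : ε i • t = t := by
  conv_rhs => rw [← one_smul R t, ← H.sum_eq_one, Finset.sum_smul]
  rw [Finset.sum_eq_single i]
  · exact fun j _ hj => H.smul_simple_eq_zero hj.symm hs0 hs t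
  · simp

variable {q : R} {i : ι} {P : Type} [AddCommGroup P] [Module R P] {u : P}

theorem exists_hom_simple (hP : IsRelProj q (ε i) P u) (hq : q * ε i = 0) :
    ∃ S : Mdl R, IsSimpleModule R S ∧ ∃ θ : P →ₗ[R] S, θ u ≠ 0 ∧ ε i • θ u = θ u ∧
      Function.Surjective θ := by
  obtain ⟨S, hS, s, hs0, hs⟩ := H.exists_simple i
  obtain ⟨θ, hθ⟩ := hP.exists_hom S (fun t => by
    rw [← H.smul_simple_eq_self hs0 hs t, ← mul_smul, hq, zero_smul]) s hs
  refine ⟨S, hS, θ, by rwa [hθ], by rwa [hθ], fun t => ?_⟩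
  obtain ⟨r, hr⟩ := exists_smul_eq_of_ne_zero (R := R) hs0 t
  exact ⟨r • u, by rw [map_smul, hθ, hr]⟩

theorem gen_ne_zero (hP : IsRelProj q (ε i) P u) (hq : q * ε i = 0) : u ≠ 0 := by
  rintro rfl
  obtain ⟨S, -, θ, h, -⟩ := H.exists_hom_simple hP hq
  exact h (map_zero θ)

theorem hasTop_relProj (hP : IsRelProj q (ε i) P u) (hq : q * ε i = 0) :
    HasTop ε (ModuleCat.of R P) i := by
  obtain ⟨S, hS, θ, h0, h, hθ⟩ := H.exists_hom_simple hP hq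
  exact ⟨S, hS, (memFac_self _).of_surjective (X := ModuleCat.of R P) θ hθ, _, h0, h⟩

theorem isIndec_relProj (hP : IsRelProj q (ε i) P u) (hq : q * ε i = 0) :
    IsIndec (ModuleCat.of R P) := by
  have : Nontrivial P := ⟨⟨u, 0, H.gen_ne_zero hP hq⟩⟩
  refine isIndec_of_idempotent fun π hπ => ?_
  obtain ⟨a, ha1, ha2, ha⟩ := hP.exists_corner_smul (H.idem i) π
  rcases H.isNilpotent_or i a ha1 ha2 with hn | ⟨y, hy⟩
  · left
    apply hP.hom_ext
    refine eq_zero_of_isNilpotent_smul hn ?_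
    rw [← map_smul, ← ha, hπ]
  · right
    apply hP.hom_ext
    have : y • π u = u := by rw [ha, ← mul_smul, hy, hP.smul_gen]
    have h2 : π u = y • π u := by
      conv_lhs => rw [← this]
      rw [map_smul, hπ]
    rw [h2, this]
    rfl

end BasicIdems

section MinGen

variable {R : Type} [Ring R] {P : Type} [AddCommGroup P] [Module R P]

/-- The tuple `X` lies in the `ε`-part of `P ^ n`, and its images under `Hom(P ^ n, P)` are the
whole `ε`-part of `P`. -/
structure IsGen (ε : R) {n : ℕ} (X : Fin n → P) : Prop where
  smul_eq : ε • X = X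
  exists_hom : ∀ v : P, ε • v = v → ∃ ψ : (Fin n → P) →ₗ[R] P, ψ X = v

/-- A generating tuple of minimal length. -/
structure IsMinGen (ε : R) {n : ℕ} (X : Fin n → P) : Prop extends IsGen ε X where
  min : ∀ m, m < n → ∀ X' : Fin m → P, ¬ IsGen ε X'

theorem exists_isMinGen (K : Type) [Field K] [Algebra K R] [FiniteDimensional K R]
    [Module.Finite R P] {ε : R} (hε : ε * ε = ε) :
    ∃ (n : ℕ) (X : Fin n → P), IsMinGen ε X := by
  classical
  have hex : ∃ (n : ℕ) (X : Fin n → P), IsGen ε X := by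
    let _ : Module K P := Module.compHom P (algebraMap K R)
    have : IsScalarTower K R P := ⟨fun c r p => by
      rw [Algebra.smul_def, mul_smul]
      rfl⟩
    have : Module.Finite K P := Module.Finite.trans R P
    obtain ⟨n, s, hs⟩ := Module.Finite.exists_fin (R := K) (M := P)
    refine ⟨n, fun k => ε • s k, funext fun k => ?_, fun v hv => ?_⟩
    · rw [Pi.smul_apply, smul_smul, hε]
    · obtain ⟨c, hc⟩ := (Submodule.mem_span_range_iff_exists_fun K).1
        (hs ▸ Submodule.mem_top : v ∈ Submodule.span K (Set.range s))
      refine ⟨∑ k, c k • LinearMap.proj k, ?_⟩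
      rw [← hv, ← hc, Finset.smul_sum, LinearMap.sum_apply]
      refine Finset.sum_congr rfl fun k _ => ?_
      rw [LinearMap.smul_apply, LinearMap.proj_apply, smul_comm]
  obtain ⟨X, hX⟩ := Nat.find_spec hex
  exact ⟨Nat.find hex, X, hX, fun m hm X' hX' => Nat.find_min hex hm ⟨X', hX'⟩⟩

theorem IsGen.of_comp {ε : R} {n : ℕ} {X : Fin (n + 1) → P} (hX : IsGen ε X) (k : Fin (n + 1))
    (φ : (Fin (n + 1) → P) →ₗ[R] P) (hφ : φ X = 0)
    (hb : Function.Bijective (φ ∘ₗ LinearMap.single R (fun _ => P) k)) :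
    IsGen ε (fun l => X (k.succAbove l)) := by
  let β := LinearEquiv.ofBijective _ hb
  let ζ : (Fin n → P) →ₗ[R] (Fin (n + 1) → P) :=
    ∑ l, LinearMap.single R (fun _ => P) (k.succAbove l) ∘ₗ LinearMap.proj l
  have hζ : X = LinearMap.single R (fun _ => P) k (X k) + ζ (fun l => X (k.succAbove l)) := by
    conv_lhs => rw [← Finset.univ_sum_single X, Fin.sum_univ_succAbove _ k]
    simp [ζ]
  have h1 : φ (ζ fun l => X (k.succAbove l)) = - β (X k) := by
    rw [hζ, map_add] at hφ
    exact eq_neg_of_add_eq_zero_right hφ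
  refine ⟨funext fun l => congrFun hX.smul_eq _, fun v hv => ?_⟩
  obtain ⟨ψ, hψ⟩ := hX.exists_hom v hv
  refine ⟨ψ ∘ₗ (ζ - LinearMap.single R (fun _ => P) k ∘ₗ β.symm.toLinearMap ∘ₗ φ ∘ₗ ζ), ?_⟩
  rw [← hψ]
  conv_rhs => rw [hζ]
  simp only [LinearMap.comp_apply, LinearMap.sub_apply, h1, LinearEquiv.coe_coe, map_neg,
    LinearEquiv.symm_apply_apply]
  rw [sub_neg_eq_add, add_comm (ζ _)]

end MinGen

namespace BasicIdems

variable {R : Type} [Ring R] [IsArtinianRing R] {ι : Type} [Fintype ι] {ε : ι → R}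
  (H : BasicIdems ε) {q : R} {i j : ι} {P : Type} [AddCommGroup P] [Module R P] {u : P}
  (hP : IsRelProj q (ε i) P u) {n : ℕ} {X : Fin n → P} (hX : IsMinGen (ε j) X)

include H hP hX

theorem comp_eq_zero_of_isMinGen {S : Type} [AddCommGroup S] [Module R S] [IsSimpleModule R S]
    (φ : (Fin n → P) →ₗ[R] P) (hφ : φ X = 0) (θ : P →ₗ[R] S) : θ ∘ₗ φ = 0 := by
  by_contra hne
  have : ∃ k, θ (φ (Pi.single k u)) ≠ 0 := by
    by_contra! h
    apply hne
    refine LinearMap.pi_ext' fun k => hP.hom_ext ?_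
    exact h k
  obtain ⟨k, hk⟩ := this
  cases n with
  | zero => exact k.elim0
  | succ n =>
    refine hX.min n (Nat.lt_succ_self n) _ (hX.toIsGen.of_comp k φ hφ ?_)
    have := hP.finite
    set φk := φ ∘ₗ LinearMap.single R (fun _ => P) k with hφk
    have hk' : θ (φk u) ≠ 0 := hk
    obtain ⟨a, ha1, ha2, ha⟩ := hP.exists_corner_smul (H.idem i) φk
    rcases H.isNilpotent_or i a ha1 ha2 with hn | ⟨y, hy⟩
    · rw [ha, map_smul, H.smul_eq_zero_of_isNilpotent hn ha1 ha2
        (by rw [← map_smul, hP.smul_gen])] at hk'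
      exact (hk' rfl).elim
    · have hs : Function.Surjective φk := by
        intro p
        obtain ⟨r, rfl⟩ := hP.exists_smul p
        refine ⟨(r * y) • u, ?_⟩
        rw [map_smul, ha, ← mul_smul, mul_assoc, hy, mul_smul, hP.smul_gen]
      exact ⟨IsNoetherian.injective_of_surjective_endomorphism φk hs, hs⟩

theorem comp_end_eq_zero_of_isMinGen {S : Type} [AddCommGroup S] [Module R S] [IsSimpleModule R S]
    (Φ : (Fin n → P) →ₗ[R] (Fin n → P)) (hΦ : Φ X = 0) (χ : (Fin n → P) →ₗ[R] S) :
    χ ∘ₗ Φ = 0 := by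
  have h : ∀ k, (χ ∘ₗ LinearMap.single R (fun _ => P) k) ∘ₗ (LinearMap.proj k ∘ₗ Φ) = 0 :=
    fun k => H.comp_eq_zero_of_isMinGen hP hX _ (congrFun hΦ k) _
  refine LinearMap.ext fun z => ?_
  have : Φ z = ∑ k, Pi.single k (Φ z k) := (Finset.univ_sum_single _).symm
  rw [LinearMap.comp_apply, this, map_sum]
  exact Finset.sum_eq_zero fun k _ => LinearMap.congr_fun (h k) z

theorem eq_zero_of_descends (Θ : (Fin n → P) →ₗ[R] (Fin n → P))
    (ϑ : ((Fin n → P) ⧸ Submodule.span R {X}) →ₗ[R] ((Fin n → P) ⧸ Submodule.span R {X}))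
    (hϑ : ∀ y, ϑ (ϑ y) = ϑ y)
    (hΘ : (Submodule.span R {X}).mkQ ∘ₗ Θ = ϑ ∘ₗ (Submodule.span R {X}).mkQ)
    {b : R} (hb : IsNilpotent b) (hbX : Θ X = b • X) : ϑ = 0 := by
  have := hP.finite
  by_contra hne
  have : Nontrivial (LinearMap.range ϑ) :=
    Submodule.nontrivial_iff_ne_bot.2 (fun h => hne (LinearMap.range_eq_bot.1 h))
  obtain ⟨N, hN⟩ := exists_simple_quotient R (LinearMap.range ϑ)
  obtain ⟨m, hm⟩ := hb
  have hpow : ∀ m : ℕ, (Θ ^ m) X = b ^ m • X := by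
    intro m
    induction m with
    | zero => simp
    | succ m ih => rw [pow_succ', Module.End.mul_apply, ih, map_smul, hbX, pow_succ, mul_smul]
  have hdesc : ∀ (m : ℕ) z, (Submodule.span R {X}).mkQ ((Θ ^ (m + 1)) z) =
      ϑ ((Submodule.span R {X}).mkQ z) := by
    intro m
    induction m with
    | zero => exact fun z => by simpa using LinearMap.congr_fun hΘ z
    | succ m ih =>
      intro z
      rw [pow_succ, Module.End.mul_apply, ih]
      have := LinearMap.congr_fun hΘ z
      rw [LinearMap.comp_apply, LinearMap.comp_apply] at this
      rw [this, hϑ]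
  let ψ := N.mkQ ∘ₗ ϑ.rangeRestrict
  have h0 : (ψ ∘ₗ (Submodule.span R {X}).mkQ) ∘ₗ (Θ ^ (m + 1)) = 0 :=
    H.comp_end_eq_zero_of_isMinGen hP hX _ (by rw [hpow, pow_succ, hm, zero_mul, zero_smul]) _
  have := IsSimpleModule.nontrivial R (LinearMap.range ϑ ⧸ N)
  obtain ⟨t, ht⟩ := exists_ne (0 : LinearMap.range ϑ ⧸ N)
  obtain ⟨⟨_, y, rfl⟩, rfl⟩ := N.mkQ_surjective t
  obtain ⟨z, rfl⟩ := (Submodule.span R {X}).mkQ_surjective y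
  apply ht
  have h1 := LinearMap.congr_fun h0 z
  rw [LinearMap.comp_apply, LinearMap.comp_apply, hdesc] at h1
  refine Eq.trans ?_ h1
  exact congrArg N.mkQ (Subtype.ext (hϑ _).symm)

end BasicIdems

theorem exists_lift_pi {R : Type} [Ring R] {P E Z : Type} [AddCommGroup P] [Module R P]
    [AddCommGroup E] [Module R E] [AddCommGroup Z] [Module R Z] {n : ℕ} (g : E →ₗ[R] Z)
    (h : ∀ φ : P →ₗ[R] Z, ∃ ψ : P →ₗ[R] E, g ∘ₗ ψ = φ)
    (φ : (Fin n → P) →ₗ[R] Z) : ∃ ψ : (Fin n → P) →ₗ[R] E, g ∘ₗ ψ = φ := by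
  choose s hs using fun k => h (φ ∘ₗ LinearMap.single R (fun _ => P) k)
  refine ⟨LinearMap.lsum R (fun _ => P) ℕ s, LinearMap.pi_ext' fun k => ?_⟩
  refine LinearMap.ext fun p => ?_
  rw [← hs k]
  simp only [LinearMap.comp_apply, LinearMap.lsum_apply, LinearMap.sum_apply,
    LinearMap.proj_apply, LinearMap.single_apply]
  rw [Finset.sum_eq_single k (fun l _ hl => by rw [Pi.single_eq_of_ne hl, map_zero]) (by simp),
    Pi.single_eq_same]

namespace IsRelProj

variable {R : Type} [Ring R] {q ε : R} {P : Type} [AddCommGroup P] [Module R P] {u : P}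
  (hP : IsRelProj q ε P u)

include hP

theorem ext1Vanish_quotient (hq : q * q = q) (hε : ε * ε = ε) {δ : R} (hδ : δ * δ = δ) {n : ℕ}
    {X : Fin n → P} (hX : IsGen δ X) {Z : Mdl R} (hZ : MemFac (ModuleCat.of R P) Z) :
    Ext1Vanish (ModuleCat.of R ((Fin n → P) ⧸ Submodule.span R {X})) Z := by
  intro E f g hf hg hfg
  have hPZ := hP.ext1Vanish hq hε (hZ.smul_eq_zero hP.smul_eq_zero)
  obtain ⟨l, hl⟩ := exists_lift_pi (n := n) g (fun φ => hPZ.exists_lift f g hf hg hfg φ)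
    (Submodule.span R {X}).mkQ
  have hlX : l X ∈ LinearMap.ker g := by
    have := LinearMap.congr_fun hl X
    rw [LinearMap.mem_ker, ← LinearMap.comp_apply, this]
    exact (Submodule.Quotient.mk_eq_zero _).2 (Submodule.mem_span_singleton_self X)
  rw [← hfg] at hlX
  obtain ⟨z, hz⟩ := hlX
  have hδz : δ • z = z := hf (by rw [map_smul, hz, ← map_smul, hX.smul_eq])
  obtain ⟨N, τ, hτ⟩ := hZ
  obtain ⟨w, hw⟩ := hτ z
  choose ψ hψ using fun k => hX.exists_hom (δ • w k) (by rw [smul_smul, hδ])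
  have h1 : τ (LinearMap.pi ψ X) = z := by
    have : LinearMap.pi ψ X = δ • w := funext hψ
    rw [this, map_smul, hw, hδz]
  let l' := l - f ∘ₗ τ ∘ₗ LinearMap.pi ψ
  have hl' : Submodule.span R {X} ≤ LinearMap.ker l' := by
    rw [Submodule.span_singleton_le_iff_mem, LinearMap.mem_ker]
    change l X - f (τ (LinearMap.pi ψ X)) = 0
    rw [h1, hz, sub_self]
  refine ⟨Submodule.liftQ _ l' hl', ?_⟩
  refine Submodule.linearMap_qext _ (LinearMap.ext fun y => ?_)
  have h2 : g (f (τ (LinearMap.pi ψ y))) = 0 := by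
    have : f (τ (LinearMap.pi ψ y)) ∈ LinearMap.ker g := hfg ▸ ⟨_, rfl⟩
    exact this
  change g (l y - f (τ (LinearMap.pi ψ y))) = _
  rw [map_sub, h2, sub_zero]
  exact LinearMap.congr_fun hl y

end IsRelProj

namespace BasicIdems

variable {R : Type} [Ring R] {ι : Type} [Fintype ι] {ε : ι → R}
  (H : BasicIdems ε) {q : R} {i j : ι} {P : Type} [AddCommGroup P] [Module R P] {u : P}
  (hP : IsRelProj q (ε i) P u) (hqi : q * ε i = 0) {n : ℕ} {X : Fin n → P}

include H hP

include hqi in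
theorem exists_hom_quotient_simple (hij : i ≠ j) (hn : n ≠ 0) (hX : ε j • X = X) :
    ∃ S : Mdl R, IsSimpleModule R S ∧
      ∃ χ : ((Fin n → P) ⧸ Submodule.span R {X}) →ₗ[R] S, χ ≠ 0 := by
  obtain ⟨S, hS, θ, h0, h, hθ⟩ := H.exists_hom_simple hP hqi
  obtain ⟨k⟩ : Nonempty (Fin n) := ⟨⟨0, Nat.pos_of_ne_zero hn⟩⟩
  refine ⟨S, hS, Submodule.liftQ _ (θ ∘ₗ LinearMap.proj k) ?_, fun h1 => h0 ?_⟩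
  · rw [Submodule.span_singleton_le_iff_mem, LinearMap.mem_ker, ← hX, map_smul]
    exact H.smul_simple_eq_zero hij h0 h _
  · simpa using LinearMap.congr_fun h1 (Submodule.Quotient.mk fun _ => u)

variable [IsArtinianRing R]

include hqi in
theorem isEmpty_equiv_quotient (hij : i ≠ j) (hn : n ≠ 0) (hX : IsMinGen (ε j) X) :
    IsEmpty (P ≃ₗ[R] ((Fin n → P) ⧸ Submodule.span R {X})) := by
  refine ⟨fun g => ?_⟩
  obtain ⟨S, hS, χ, hχ⟩ := H.exists_hom_quotient_simple hP hqi hij hn hX.smul_eq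
  have h := H.comp_eq_zero_of_isMinGen hP hX
    (g.symm.toLinearMap ∘ₗ (Submodule.span R {X}).mkQ) (by simp) (χ ∘ₗ g.toLinearMap)
  apply hχ
  refine Submodule.linearMap_qext _ (LinearMap.ext fun y => ?_)
  have := LinearMap.congr_fun h y
  simpa using this

theorem eq_zero_or_eq_id_of_descends (hij : i ≠ j) (hX : IsMinGen (ε j) X) (hX0 : X ≠ 0)
    (ϑ : ((Fin n → P) ⧸ Submodule.span R {X}) →ₗ[R] ((Fin n → P) ⧸ Submodule.span R {X}))
    (hϑ : ∀ y, ϑ (ϑ y) = ϑ y) (Θ : (Fin n → P) →ₗ[R] (Fin n → P))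
    (hΘ : (Submodule.span R {X}).mkQ ∘ₗ Θ = ϑ ∘ₗ (Submodule.span R {X}).mkQ) :
    ϑ = 0 ∨ ϑ = LinearMap.id := by
  have hΘ' : ∀ z, (Submodule.span R {X}).mkQ (Θ z) = ϑ ((Submodule.span R {X}).mkQ z) :=
    LinearMap.congr_fun hΘ
  have hmem : ∀ z, (Submodule.span R {X}).mkQ z = 0 → ∃ r : R, r • X = z := fun z hz =>
    Submodule.mem_span_singleton.1 ((Submodule.Quotient.mk_eq_zero _).1 hz)
  obtain ⟨b₀, hb₀⟩ := hmem (Θ X) (by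
    have : (Submodule.span R {X}).mkQ X = 0 :=
      (Submodule.Quotient.mk_eq_zero _).2 (Submodule.mem_span_singleton_self X)
    rw [hΘ', this, map_zero])
  obtain ⟨b, hb1, hb2, hb⟩ : ∃ b : R, ε j * b = b ∧ b * ε j = b ∧ Θ X = b • X := by
    refine ⟨ε j * b₀ * ε j, by simp only [← mul_assoc, H.idem],
      by simp only [mul_assoc, H.idem], ?_⟩
    rw [mul_smul, hX.smul_eq, mul_smul, hb₀, ← map_smul, hX.smul_eq]
  choose d hd using fun k => hP.exists_smul (X k)
  choose c hc using fun k => hmem (Θ (Θ (Pi.single k u)) - Θ (Pi.single k u))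
    (by rw [map_sub, hΘ', hΘ', hϑ, sub_self])
  have hXs : X = ∑ k, (d k * ε i) • Pi.single k u := by
    conv_lhs => rw [← Finset.univ_sum_single X]
    refine Finset.sum_congr rfl fun k _ => ?_
    rw [← Pi.single_smul, mul_smul, hP.smul_gen, hd]
  have hrel : (b * b - b - ∑ k, d k * ε i * c k) • X = 0 := by
    have h1 : Θ (Θ X) - Θ X = ∑ k, (d k * ε i * c k) • X := by
      conv_lhs => rw [hXs]
      simp only [map_sum, map_smul, ← Finset.sum_sub_distrib, ← smul_sub]
      refine Finset.sum_congr rfl fun k _ => ?_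
      rw [← hc, ← mul_smul]
    rw [hb, map_smul, hb, ← mul_smul, ← sub_smul] at h1
    rw [sub_smul, Finset.sum_smul, h1, sub_self]
  have hXmem := Submodule.mem_span_singleton_self (R := R) X
  have : Nontrivial (Submodule.span R {X}) :=
    ⟨⟨⟨X, hXmem⟩, 0, fun h => hX0 (congrArg Subtype.val h)⟩⟩
  have := Module.Finite.span_singleton R X
  obtain ⟨N, hN⟩ := exists_simple_quotient R (Submodule.span R {X})
  set s := N.mkQ ⟨X, hXmem⟩ with hs
  have hsmul : ∀ r : R, r • X = 0 → r • s = 0 := fun r hr => by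
    have : r • (⟨X, hXmem⟩ : Submodule.span R {X}) = 0 := Subtype.ext hr
    rw [hs, ← map_smul, this, map_zero]
  have hεs : ε j • s = s := by
    have : ε j • (⟨X, hXmem⟩ : Submodule.span R {X}) = ⟨X, hXmem⟩ := Subtype.ext hX.smul_eq
    rw [hs, ← map_smul, this]
  have hs0 : s ≠ 0 := by
    intro h0
    have := IsSimpleModule.nontrivial R (Submodule.span R {X} ⧸ N)
    obtain ⟨t, ht⟩ := exists_ne (0 : Submodule.span R {X} ⧸ N)
    obtain ⟨⟨y, hy⟩, rfl⟩ := N.mkQ_surjective t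
    obtain ⟨r, rfl⟩ := Submodule.mem_span_singleton.1 hy
    apply ht
    have : (⟨r • X, hy⟩ : Submodule.span R {X}) = r • ⟨X, hXmem⟩ := rfl
    rw [this, map_smul, ← hs, h0, smul_zero]
  have hbs : (b * b - b) • s = 0 := by
    have := hsmul _ hrel
    rwa [sub_smul, Finset.sum_smul, Finset.sum_eq_zero, sub_zero] at this
    intro k _
    rw [mul_smul, mul_smul, H.smul_simple_eq_zero hij.symm hs0 hεs, smul_zero]
  rcases H.isNilpotent_or j b hb1 hb2 with hn | ⟨y, hy⟩
  · exact Or.inl (H.eq_zero_of_descends hP hX Θ ϑ hϑ hΘ hn hb)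
  · right
    have hc1 : ε j * (ε j - b) = ε j - b := by rw [mul_sub, H.idem, hb1]
    have hc2 : (ε j - b) * ε j = ε j - b := by rw [sub_mul, H.idem, hb2]
    have hcs : (ε j - b) • s = 0 := by
      have h1 : (y * (b * b - b)) • s = 0 := by rw [mul_smul, hbs, smul_zero]
      rw [mul_sub, ← mul_assoc, hy, hb1, ← neg_sub, neg_smul] at h1
      exact neg_eq_zero.1 h1
    have hcn : IsNilpotent (ε j - b) := by
      rcases H.isNilpotent_or j _ hc1 hc2 with hn | ⟨z, hz⟩
      · exact hn
      · refine (hs0 ?_).elim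
        rw [← hεs, ← hz, mul_smul, hcs, smul_zero]
    have := H.eq_zero_of_descends hP hX (LinearMap.id - Θ) (LinearMap.id - ϑ)
      (fun y => by simp [hϑ]) (LinearMap.ext fun z => by
        simp only [LinearMap.comp_apply, LinearMap.sub_apply, LinearMap.id_apply, map_sub, hΘ']) hcn
      (by rw [LinearMap.sub_apply, hb, sub_smul, hX.smul_eq]; rfl)
    exact (sub_eq_zero.1 this).symm

include hqi in
theorem isIndec_quotient (hij : i ≠ j) (hX : IsMinGen (ε j) X) (hX0 : X ≠ 0) :
    IsIndec (ModuleCat.of R ((Fin n → P) ⧸ Submodule.span R {X})) := by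
  have hn : n ≠ 0 := by
    rintro rfl
    exact hX0 (Subsingleton.elim _ _)
  obtain ⟨S, -, χ, hχ⟩ := H.exists_hom_quotient_simple hP hqi hij hn hX.smul_eq
  have : Nontrivial ((Fin n → P) ⧸ Submodule.span R {X}) := by
    by_contra h
    rw [not_nontrivial_iff_subsingleton] at h
    exact hχ (Subsingleton.elim _ _)
  refine isIndec_of_idempotent fun ϑ hϑ => ?_
  obtain ⟨Θ, hΘ⟩ := exists_lift_pi (n := n) (Submodule.span R {X}).mkQ
    (hP.exists_lift (H.idem i)
      (fun m => funext fun k => hP.smul_eq_zero (m k)) _ (Submodule.mkQ_surjective _))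
    (ϑ ∘ₗ (Submodule.span R {X}).mkQ)
  exact H.eq_zero_or_eq_id_of_descends hP hij hX hX0 ϑ hϑ Θ hΘ

end BasicIdems

/-- `M` and `N` have a least upper bound `J` in the poset cut out by `PA`, and the open interval
between `M` and `J` is non-empty. -/
def HasLink {A : Type} [Ring A] (PA : Mdl A → Prop) (M N : Mdl A) : Prop :=
  ∃ C J, PA C ∧ PA J ∧ FacLE M J ∧ FacLE N J ∧
    (∀ T, PA T → FacLE M T → FacLE N T → FacLE J T) ∧ FacLT M C ∧ FacLT C J

/-- Basic support τ-tilting modules with respect to a family of idempotents. -/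
structure IsBasicSTT {R : Type} [Ring R] {ι : Type} (ε : ι → R) (M : Mdl R) : Prop where
  isTauRigid : IsTauRigid M
  hasNumSummands : HasNumSummands M {i | ∃ m : M, ε i • m ≠ 0}.ncard
  isBasicMod : IsBasicMod M

theorem isBSTT_iff {Λ : Type} [Ring Λ] {ι : Type} [Fintype ι] {e : ι → Λ} {M : Mdl Λᵐᵒᵖ} :
    IsBSTT Λ e M ↔ IsBasicSTT (fun i => op (e i)) M :=
  ⟨fun h => ⟨h.1.2.1, h.1.2.2, h.2⟩, fun h => ⟨⟨h.1.1, h.1, h.2⟩, h.3⟩⟩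

theorem HasTop.of_memFac {R : Type} [Ring R] {ι : Type} {ε : ι → R} {T M : Mdl R} {i : ι}
    (h : HasTop ε M i) (hM : MemFac T M) : HasTop ε T i := by
  obtain ⟨S, hS, hMS, hs⟩ := h
  exact ⟨S, hS, hM.trans hMS, hs⟩

theorem exists_isRelProj {R : Type} [Ring R] (q : R) {ε : R} :
    ∃ (P : Mdl R) (u : P), IsRelProj q ε P u := by
  let L : Submodule R R := Submodule.span R ({1 - ε} ∪ Set.range fun a => q * a)
  have h1 : 1 - ε ∈ L := Submodule.subset_span (Or.inl rfl)
  refine ⟨ModuleCat.of R (R ⧸ L), L.mkQ 1, ?_, ?_, ?_, ?_⟩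
  · rw [← map_smul, ← sub_eq_zero, ← map_sub, smul_eq_mul, mul_one, ← neg_sub, map_neg, neg_eq_zero]
    exact (Submodule.Quotient.mk_eq_zero _).2 h1
  · intro p
    obtain ⟨a, rfl⟩ := L.mkQ_surjective p
    rw [← map_smul]
    exact (Submodule.Quotient.mk_eq_zero _).2 (Submodule.subset_span (Or.inr ⟨a, rfl⟩))
  · intro p
    obtain ⟨a, rfl⟩ := L.mkQ_surjective p
    exact ⟨a, by rw [← map_smul, smul_eq_mul, mul_one]⟩
  · intro M _ _ hM m hm
    refine ⟨L.liftQ (LinearMap.toSpanSingleton R M m) ?_, ?_⟩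
    · rw [Submodule.span_le]
      rintro _ (rfl | ⟨a, rfl⟩)
      · simp [sub_smul, hm]
      · simp [mul_smul, hM]
    · simp

theorem isBasicSTT_of_subsingleton {R : Type} [Ring R] {ι : Type} (ε : ι → R) (M : Type)
    [AddCommGroup M] [Module R M] [Subsingleton M] :
    IsBasicSTT ε (ModuleCat.of R M) := by
  refine ⟨⟨inferInstanceAs (Module.Finite R M), fun X _ E f g _ _ _ => ⟨0, ?_⟩⟩, ?_,
    (hasNumSummands_zero M).2⟩
  · exact LinearMap.ext fun m => Subsingleton.elim (α := M) _ _
  · have : {i | ∃ m : M, ε i • m ≠ 0} = ∅ :=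
      Set.eq_empty_iff_forall_notMem.2 fun i ⟨m, hm⟩ => hm (Subsingleton.elim _ _)
    have h0 := (hasNumSummands_zero (R := R) M).1
    rwa [← Set.ncard_empty ι, ← this] at h0

namespace BasicIdems

variable {R : Type} [Ring R] {ι : Type} [Fintype ι] {ε : ι → R} (H : BasicIdems ε)

include H

theorem not_hasTop_relProj {q : R} {i j : ι} {P : Type} [AddCommGroup P] [Module R P] {u : P}
    (hP : IsRelProj q (ε i) P u) (hij : i ≠ j) : ¬ HasTop ε (ModuleCat.of R P) j := by
  rintro ⟨S, hS, ⟨n, f, hf⟩, s, hs0, hs⟩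
  obtain ⟨z, rfl⟩ := hf s
  have hf0 : f = 0 := by
    refine LinearMap.pi_ext' fun k => hP.hom_ext ?_
    change (f ∘ₗ LinearMap.single R (fun _ => P) k) u = 0
    rw [← hP.smul_gen, map_smul]
    exact H.smul_simple_eq_zero hij.symm hs0 hs _
  rw [hf0] at hs0
  exact hs0 rfl

theorem mul_one_sub_sub_eq {i j k : ι} (hi : k ≠ i) (hj : k ≠ j) :
    ε k * (1 - ε i - ε j) = ε k := by
  rw [mul_sub, mul_sub, mul_one, H.orth k i hi, H.orth k j hj, sub_zero, sub_zero]

theorem one_sub_sub_mul_left {i j : ι} (hij : i ≠ j) : (1 - ε i - ε j) * ε i = 0 := by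
  rw [sub_mul, sub_mul, one_mul, H.idem, H.orth j i hij.symm, sub_self, sub_zero]

theorem one_sub_sub_mul_right {i j : ι} (hij : i ≠ j) : (1 - ε i - ε j) * ε j = 0 := by
  rw [sub_mul, sub_mul, one_mul, H.idem, H.orth i j hij, sub_zero, sub_self]

theorem one_sub_sub_mul_self {i j : ι} (hij : i ≠ j) :
    (1 - ε i - ε j) * (1 - ε i - ε j) = 1 - ε i - ε j := by
  rw [mul_sub, mul_sub, mul_one, H.one_sub_sub_mul_left hij, H.one_sub_sub_mul_right hij,
    sub_zero, sub_zero]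

theorem one_sub_mul (i : ι) : (1 - ε i) * ε i = 0 := by
  rw [sub_mul, one_mul, H.idem, sub_self]

theorem one_sub_mul_self (i : ι) : (1 - ε i) * (1 - ε i) = 1 - ε i := by
  rw [mul_sub, mul_one, H.one_sub_mul, sub_zero]

section Simple

variable {i : ι} {X : Type} [AddCommGroup X] [Module R X] {x : X}
  (hX : IsRelProj (1 - ε i) (ε i) X x)

include hX

theorem smul_eq_zero_of_isRelProj {k : ι} (hk : k ≠ i) (p : X) : ε k • p = 0 := by
  have : ε k * (1 - ε i) = ε k := by rw [mul_sub, mul_one, H.orth k i hk, sub_zero]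
  rw [← this, mul_smul, hX.smul_eq_zero, smul_zero]

theorem isTauRigid_simple : IsTauRigid (ModuleCat.of R X) :=
  hX.isTauRigid (H.one_sub_mul_self i) (H.idem i)

theorem isBasicSTT_simple : IsBasicSTT ε (ModuleCat.of R X) := by
  have h1 := hasNumSummands_one (H.isIndec_relProj hX (H.one_sub_mul i))
  refine ⟨H.isTauRigid_simple hX, ?_, h1.2⟩
  have : {k | ∃ p : X, ε k • p ≠ 0} = {i} := by
    ext k
    refine ⟨fun ⟨p, hp⟩ => ?_, ?_⟩
    · by_contra hk
      exact hp (H.smul_eq_zero_of_isRelProj hX hk p)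
    · rintro rfl
      exact ⟨x, by rw [hX.smul_gen]; exact H.gen_ne_zero hX (H.one_sub_mul k)⟩
  have h2 := h1.1
  rwa [← Set.ncard_singleton i, ← this] at h2

theorem memFac_simple_iff [IsArtinianRing R] {T : Mdl R} (hT : IsTauRigid T) :
    MemFac T (ModuleCat.of R X) ↔ HasTop ε T i := by
  refine ⟨fun h => (H.hasTop_relProj hX (H.one_sub_mul i)).of_memFac h, fun h => ?_⟩
  have := hX.finite
  refine H.memFac_of_hasTop hT fun k ⟨p, hp⟩ => ?_
  obtain rfl : k = i := by
    by_contra hk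
    exact hp (H.smul_eq_zero_of_isRelProj hX hk p)
  exact h

theorem facLE_simple_iff [IsArtinianRing R] {T : Mdl R} (hT : IsTauRigid T) :
    FacLE (ModuleCat.of R X) T ↔ HasTop ε T i :=
  facLE_iff.trans (H.memFac_simple_iff hX hT)

end Simple

section Pair

variable {i j : ι} (hij : i ≠ j) {P P' : Type} [AddCommGroup P] [Module R P] [AddCommGroup P']
  [Module R P'] {u : P} {u' : P'} (hP : IsRelProj (1 - ε i - ε j) (ε i) P u)
  (hP' : IsRelProj (1 - ε i - ε j) (ε j) P' u')

include hij hP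

theorem isEmpty_equiv (hP' : IsRelProj (1 - ε i - ε j) (ε j) P' u') : IsEmpty (P ≃ₗ[R] P') := by
  refine ⟨fun g => H.not_hasTop_relProj hP' hij.symm ?_⟩
  exact (H.hasTop_relProj hP (H.one_sub_sub_mul_left hij)).of_memFac
    ((memFac_self (ModuleCat.of R P')).of_surjective (X := ModuleCat.of R P')
      (Z := ModuleCat.of R P) g.symm.toLinearMap g.symm.surjective)

omit hP in
theorem ncard_support {M : Type} [AddCommGroup M] [Module R M]
    (hM : ∀ m : M, (1 - ε i - ε j) • m = 0) (hi : ∃ m : M, ε i • m ≠ 0)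
    (hj : ∃ m : M, ε j • m ≠ 0) : {k | ∃ m : M, ε k • m ≠ 0}.ncard = 2 := by
  have : {k | ∃ m : M, ε k • m ≠ 0} = {i, j} := by
    ext k
    refine ⟨fun ⟨m, hm⟩ => ?_, ?_⟩
    · by_contra hk
      rw [Set.mem_insert_iff, Set.mem_singleton_iff, not_or] at hk
      apply hm
      rw [← H.mul_one_sub_sub_eq hk.1 hk.2, mul_smul, hM, smul_zero]
    · rintro (rfl | rfl)
      · exact hi
      · exact hj
  rw [this, Set.ncard_pair hij]

include hP' in
theorem isTauRigid_dsum : IsTauRigid (dsum (ModuleCat.of R P) (ModuleCat.of R P')) := by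
  have := hP.finite
  have := hP'.finite
  refine ⟨inferInstanceAs (Module.Finite R (P × P')), fun X hX => ?_⟩
  have hX' : ∀ x : X, (1 - ε i - ε j) • x = 0 := hX.smul_eq_zero fun (m : P × P') =>
    Prod.ext (hP.smul_eq_zero _) (hP'.smul_eq_zero _)
  exact (hP.ext1Vanish (H.one_sub_sub_mul_self hij) (H.idem i) hX').prod
    (hP'.ext1Vanish (H.one_sub_sub_mul_self hij) (H.idem j) hX')

include hP' in
theorem isBasicSTT_dsum : IsBasicSTT ε (dsum (ModuleCat.of R P) (ModuleCat.of R P')) := by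
  have hu := H.gen_ne_zero hP (H.one_sub_sub_mul_left hij)
  have hu' := H.gen_ne_zero hP' (H.one_sub_sub_mul_right hij)
  have h := hasNumSummands_prod (H.isIndec_relProj hP (H.one_sub_sub_mul_left hij))
    (H.isIndec_relProj hP' (H.one_sub_sub_mul_right hij)) (H.isEmpty_equiv hij hP hP')
  refine ⟨H.isTauRigid_dsum hij hP hP', ?_, h.2⟩
  have h2 := h.1
  rwa [← H.ncard_support hij (M := P × P')
    (fun m => Prod.ext (hP.smul_eq_zero _) (hP'.smul_eq_zero _))
    ⟨(u, 0), fun h => hu (hP.smul_gen ▸ congrArg Prod.fst h)⟩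
    ⟨(0, u'), fun h => hu' (hP'.smul_gen ▸ congrArg Prod.snd h)⟩] at h2

include hP' in
theorem hasTop_dsum : HasTop ε (dsum (ModuleCat.of R P) (ModuleCat.of R P')) i ∧
    HasTop ε (dsum (ModuleCat.of R P) (ModuleCat.of R P')) j := by
  let J := dsum (ModuleCat.of R P) (ModuleCat.of R P')
  exact ⟨(H.hasTop_relProj hP (H.one_sub_sub_mul_left hij)).of_memFac
    ((memFac_self J).of_surjective (X := J) (Z := ModuleCat.of R P) (LinearMap.fst R P P')
      LinearMap.fst_surjective),
    (H.hasTop_relProj hP' (H.one_sub_sub_mul_right hij)).of_memFac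
    ((memFac_self J).of_surjective (X := J) (Z := ModuleCat.of R P') (LinearMap.snd R P P')
      LinearMap.snd_surjective)⟩

theorem exists_isBasicSTT_dsum_quotient [IsArtinianRing R] (K : Type) [Field K] [Algebra K R]
    [FiniteDimensional K R] (hj : ∃ p : P, ε j • p ≠ 0) :
    ∃ Y : Mdl R, MemFac (ModuleCat.of R P) Y ∧ IsBasicSTT ε (dsum (ModuleCat.of R P) Y) := by
  have := hP.finite
  obtain ⟨n, X, hX⟩ := exists_isMinGen (P := P) K (H.idem j)
  obtain ⟨p, hp⟩ := hj
  have hX0 : X ≠ 0 := by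
    rintro rfl
    obtain ⟨ψ, hψ⟩ := hX.exists_hom (ε j • p) (H.smul_smul j p)
    exact hp (hψ.symm.trans (map_zero ψ))
  have hn : n ≠ 0 := by
    rintro rfl
    exact hX0 (Subsingleton.elim _ _)
  have hq := H.one_sub_sub_mul_left hij
  let Y := ModuleCat.of R ((Fin n → P) ⧸ Submodule.span R {X})
  have hY : MemFac (ModuleCat.of R P) Y :=
    ⟨n, (Submodule.span R {X}).mkQ, Submodule.mkQ_surjective _⟩
  have hu := H.gen_ne_zero hP hq
  have hC : MemFac (ModuleCat.of R P) (dsum (ModuleCat.of R P) Y) := (memFac_self _).prod hY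
  have h := hasNumSummands_prod (H.isIndec_relProj hP hq)
    (H.isIndec_quotient hP hq hij hX hX0) (H.isEmpty_equiv_quotient hP hq hij hn hX)
  refine ⟨Y, hY, ⟨inferInstanceAs (Module.Finite R (P × Y)), fun Z hZ => ?_⟩, ?_, h.2⟩
  · have hZ' := hC.trans hZ
    exact (hP.ext1Vanish (H.one_sub_sub_mul_self hij) (H.idem i)
      (hZ'.smul_eq_zero hP.smul_eq_zero)).prod
      (hP.ext1Vanish_quotient (H.one_sub_sub_mul_self hij) (H.idem i) (H.idem j) hX.toIsGen hZ')
  · have h2 := h.1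
    rwa [← H.ncard_support hij (M := P × Y) (hC.smul_eq_zero hP.smul_eq_zero)
      ⟨(u, 0), fun h => hu (hP.smul_gen ▸ congrArg Prod.fst h)⟩
      ⟨(p, 0), fun h => hp (congrArg Prod.fst h)⟩] at h2

end Pair

end BasicIdems

namespace BasicIdems

variable {R : Type} [Ring R] [IsArtinianRing R] {ι : Type} [Fintype ι] {ε : ι → R}
  (H : BasicIdems ε) {i j : ι} (hij : i ≠ j) {X X' : Type} [AddCommGroup X] [Module R X]
  [AddCommGroup X'] [Module R X'] {x : X} {x' : X'} (hX : IsRelProj (1 - ε i) (ε i) X x)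
  (hX' : IsRelProj (1 - ε j) (ε j) X' x')

include H hij hX hX'

theorem hasLink_of_smul_ne_zero (K : Type) [Field K] [Algebra K R] [FiniteDimensional K R]
    {M : Type} [AddCommGroup M] [Module R M] (hM : ∀ m : M, (1 - ε i - ε j) • m = 0)
    {r : R} {m : M} (hr : ε j • r • ε i • m ≠ 0) :
    HasLink (IsBasicSTT ε) (ModuleCat.of R X) (ModuleCat.of R X') := by
  obtain ⟨P, u, hP⟩ := exists_isRelProj (1 - ε i - ε j) (ε := ε i)
  obtain ⟨P', u', hP'⟩ := exists_isRelProj (1 - ε i - ε j) (ε := ε j)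
  obtain ⟨φ, hφ⟩ := hP.exists_hom M hM (ε i • m) (H.smul_smul i m)
  have hp : ε j • r • u ≠ 0 := fun h => hr (by rw [← hφ, ← map_smul, ← map_smul, h, map_zero])
  obtain ⟨Y, hY, hC⟩ := H.exists_isBasicSTT_dsum_quotient hij hP K ⟨_, hp⟩
  have hJ := H.isBasicSTT_dsum hij hP hP'
  have hJtop := H.hasTop_dsum hij hP hP'
  have hPC : MemFac P (dsum P Y) := (memFac_self P).prod hY
  have hCP : MemFac (dsum P Y) P := (memFac_self (dsum P Y)).of_surjective (X := dsum P Y)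
    (LinearMap.fst R P Y) LinearMap.fst_surjective
  have hJP : MemFac (dsum P P') P := (memFac_self (dsum P P')).of_surjective (X := dsum P P')
    (LinearMap.fst R P P') LinearMap.fst_surjective
  have hPtop := H.hasTop_relProj hP (H.one_sub_sub_mul_left hij)
  refine ⟨dsum P Y, dsum P P', hC, hJ, (H.facLE_simple_iff hX hJ.isTauRigid).2 hJtop.1,
    (H.facLE_simple_iff hX' hJ.isTauRigid).2 hJtop.2, fun T hT hi hj => facLE_iff.2 ?_,
    ⟨(H.facLE_simple_iff hX hC.isTauRigid).2 (hPtop.of_memFac hCP), fun h => ?_⟩,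
    ⟨facLE_iff.2 (hJP.trans hPC), fun h => ?_⟩⟩
  · have : Module.Finite R (P × P') := hJ.isTauRigid.1
    refine H.memFac_of_hasTop hT.isTauRigid (M := P × P') fun k ⟨p, hp⟩ => ?_
    by_cases hki : k = i
    · exact hki ▸ (H.facLE_simple_iff hX hT.isTauRigid).1 hi
    by_cases hkj : k = j
    · exact hkj ▸ (H.facLE_simple_iff hX' hT.isTauRigid).1 hj
    refine (hp ?_).elim
    rw [← H.mul_one_sub_sub_eq hki hkj, mul_smul,
      show (1 - ε i - ε j) • p = 0 from Prod.ext (hP.smul_eq_zero _) (hP'.smul_eq_zero _),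
      smul_zero]
  · exact hp (((facLE_iff.1 h).trans hCP).smul_eq_zero
      (H.smul_eq_zero_of_isRelProj hX hij.symm) (r • u))
  · exact H.not_hasTop_relProj hP hij ((hJtop.2.of_memFac (facLE_iff.1 h)).of_memFac hPC)

theorem exists_smul_ne_zero_of_hasLink
    (h : HasLink (IsBasicSTT ε) (ModuleCat.of R X) (ModuleCat.of R X')) :
    ∃ M : Mdl R, (∀ m : M, (1 - ε i - ε j) • m = 0) ∧ ∃ (r : R) (m : M),
      ε j • r • ε i • m ≠ 0 := by
  obtain ⟨C, J, hC, hJ, hXJ, hXJ', hmin, ⟨hXC, hCX⟩, hCJ, hJC⟩ := h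
  obtain ⟨P, u, hP⟩ := exists_isRelProj (1 - ε i - ε j) (ε := ε i)
  obtain ⟨P', u', hP'⟩ := exists_isRelProj (1 - ε i - ε j) (ε := ε j)
  have hD := H.isBasicSTT_dsum hij hP hP'
  have hDtop := H.hasTop_dsum hij hP hP'
  have hDC : MemFac (dsum P P') C := facLE_iff.1 <| hCJ.trans <|
    hmin _ hD ((H.facLE_simple_iff hX hD.isTauRigid).2 hDtop.1)
      ((H.facLE_simple_iff hX' hD.isTauRigid).2 hDtop.2)
  have hqC : ∀ c : C, (1 - ε i - ε j) • c = 0 := hDC.smul_eq_zero fun (p : P × P') =>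
    Prod.ext (hP.smul_eq_zero _) (hP'.smul_eq_zero _)
  have hCi := (H.facLE_simple_iff hX hC.isTauRigid).1 hXC
  have := hC.isTauRigid.1
  have hk : ∀ k, k ≠ i → k ≠ j → ∀ c : C, ε k • c = 0 := fun k hki hkj c => by
    rw [← H.mul_one_sub_sub_eq hki hkj, mul_smul, hqC, smul_zero]
  refine ⟨C, hqC, ?_⟩
  by_contra! hzero
  obtain ⟨c, hc⟩ : ∃ c : C, ε j • c ≠ 0 := by
    by_contra! hcj
    refine hCX (facLE_iff.2 (H.memFac_of_hasTop (H.isTauRigid_simple hX) fun k ⟨c, hc⟩ => ?_))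
    obtain rfl : k = i := by
      by_contra hki
      by_cases hkj : k = j
      · exact hc (hkj ▸ hcj c)
      · exact hc (hk k hki hkj c)
    exact H.hasTop_relProj hX (H.one_sub_mul k)
  let N : Submodule R C := Submodule.span R (Set.range fun c : C => ε i • c)
  have hN : ∀ y ∈ N, ε j • y = 0 := by
    intro y hy
    induction hy using Submodule.span_induction with
    | mem y hy =>
      obtain ⟨c, rfl⟩ := hy
      simpa using hzero 1 c
    | zero => rw [smul_zero]
    | add y z _ _ hy hz => rw [smul_add, hy, hz, add_zero]
    | smul a y hy _ =>
      clear * - hy hzero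
      induction hy using Submodule.span_induction generalizing a with
      | mem y hy =>
        obtain ⟨c, rfl⟩ := hy
        exact hzero a c
      | zero => rw [smul_zero, smul_zero]
      | add y z _ _ hy hz => rw [smul_add, smul_add, hy, hz, add_zero]
      | smul b y _ hy => rw [← mul_smul a, hy]
  have hNi : ∀ y : C ⧸ N, ε i • y = 0 := by
    intro y
    obtain ⟨c, rfl⟩ := N.mkQ_surjective y
    rw [← map_smul]
    exact (Submodule.Quotient.mk_eq_zero _).2 (Submodule.subset_span ⟨c, rfl⟩)
  have : Nontrivial (C ⧸ N) := by
    refine ⟨N.mkQ c, 0, fun h => hc (hN c ((Submodule.Quotient.mk_eq_zero _).1 h))⟩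
  obtain ⟨k, hCk, y, hy⟩ := H.hasTop_of_nontrivial (T := C) (M := C ⧸ N)
    ((memFac_self C).of_surjective (Z := ModuleCat.of R (C ⧸ N)) N.mkQ N.mkQ_surjective)
  obtain rfl : k = j := by
    by_contra hkj
    by_cases hki : k = i
    · exact hy (hki ▸ hNi y)
    · obtain ⟨c, rfl⟩ := N.mkQ_surjective y
      rw [← map_smul, hk k hki hkj, map_zero] at hy
      exact hy rfl
  exact hJC (hmin C hC hXC ((H.facLE_simple_iff hX' hC.isTauRigid).2 hCk))

end BasicIdems

theorem exists_pow_eq_pow_succ_mul (K : Type) [Field K] {A : Type} [Ring A] [Algebra K A]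
    [FiniteDimensional K A] (x : A) : ∃ (n : ℕ) (y : A), Commute x y ∧ x ^ n = x ^ (n + 1) * y := by
  obtain ⟨g, hg, hg0⟩ := Polynomial.exists_eq_pow_rootMultiplicity_mul_and_not_dvd (minpoly K x)
    (minpoly.ne_zero (Algebra.IsIntegral.isIntegral x)) 0
  generalize (minpoly K x).rootMultiplicity 0 = n at hg
  rw [Polynomial.C_0, sub_zero] at hg hg0
  have hc : g.coeff 0 ≠ 0 := fun h => hg0 (Polynomial.X_dvd_iff.2 h)
  have h : x ^ n * (Polynomial.aeval x g) = 0 := by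
    have := minpoly.aeval K x
    rwa [hg, map_mul, map_pow, Polynomial.aeval_X] at this
  have hg' : Polynomial.aeval x g =
      x * Polynomial.aeval x g.divX + algebraMap K A (g.coeff 0) := by
    conv_lhs => rw [← Polynomial.X_mul_divX_add g]
    rw [map_add, map_mul, Polynomial.aeval_X, Polynomial.aeval_C]
  refine ⟨n, -((g.coeff 0)⁻¹ • Polynomial.aeval x g.divX), ?_, ?_⟩
  · exact ((Polynomial.aeval_X (R := K) x ▸
      (Commute.all Polynomial.X g.divX).map (Polynomial.aeval x)).smul_right _).neg_right
  · rw [hg', mul_add, ← mul_assoc, ← pow_succ, ← Algebra.commutes, ← Algebra.smul_def,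
      add_eq_zero_iff_neg_eq] at h
    rw [mul_neg, mul_smul_comm, ← smul_neg, h, smul_smul, inv_mul_cancel₀ hc, one_smul]

/-- The corner of a finite-dimensional algebra at a primitive idempotent is local. -/
theorem IsPrimIdem.isNilpotent_or (K : Type) [Field K] {A : Type} [Ring A] [Algebra K A]
    [FiniteDimensional K A] {c x : A} (hc : IsPrimIdem A c) (h1 : c * x = x) (h2 : x * c = x) :
    IsNilpotent x ∨ (∃ y, y * x = c) ∧ ∃ y, x * y = c := by
  obtain ⟨n, y, hxy, h⟩ := exists_pow_eq_pow_succ_mul K x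
  have hk : ∀ k, x ^ (n + 1) = x ^ (n + 1) * (x ^ k * y ^ k) := by
    intro k
    induction k with
    | zero => simp
    | succ k ih =>
      have h' : x ^ (n + 1) = x ^ (n + 1) * (x * y) := by
        rw [← mul_assoc, ← pow_succ, pow_succ' x (n + 1), mul_assoc, ← h, ← pow_succ']
      rw [← hxy.mul_pow] at ih ⊢
      rw [pow_succ (x * y), ← mul_assoc, ← ih, ← h']
  have hx : x ^ (n + 1) = x ^ n * x := pow_succ x n
  have hx' : x ^ (n + 1) = x * x ^ n := pow_succ' x n
  set f := x ^ (n + 1) * y ^ (n + 1) with hf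
  have hcomm : f = y ^ (n + 1) * x ^ (n + 1) := (hxy.pow_pow _ _).eq
  have hcf : c * f = f := by rw [hf, hx', ← mul_assoc, ← mul_assoc, h1]
  have hfc : f * c = f := by rw [hcomm, mul_assoc, hx, mul_assoc, h2]
  have hxf : x ^ (n + 1) = x ^ (n + 1) * f := hk (n + 1)
  have hff : f * f = f := by
    conv_rhs => rw [hcomm, hxf, ← mul_assoc, ← hcomm]
  rcases hc.2.2 f (c - f) hff (by
    change _ * _ = _
    rw [mul_sub, sub_mul, sub_mul, hc.1.eq, hfc, hcf, hff, sub_self, sub_zero])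
    (by rw [mul_sub, hfc, hff, sub_self]) (by rw [sub_mul, hcf, hff, sub_self])
    (add_sub_cancel _ _) with h0 | h0
  · exact Or.inl ⟨n + 1, by rw [hxf, h0, mul_zero]⟩
  · have h0' : f = c := (sub_eq_zero.1 h0).symm
    exact Or.inr ⟨⟨y ^ (n + 1) * x ^ n, by rw [mul_assoc, ← hx, ← hcomm, h0']⟩,
      ⟨x ^ n * y ^ (n + 1), by rw [← mul_assoc, ← hx', ← hf, h0']⟩⟩

section Quotient

variable {A : Type} [Ring A]

theorem isRelProj_quotMod {S : Submodule Aᵐᵒᵖ A} {q c : A} (h1 : 1 - c ∈ S)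
    (h2 : ∀ a, a * q ∈ S) (h3 : ∀ S' : Submodule Aᵐᵒᵖ A, 1 - c ∈ S' → (∀ a, a * q ∈ S') → S ≤ S') :
    IsRelProj (op q) (op c) (A ⧸ S) (Submodule.Quotient.mk (1 : A)) where
  smul_gen := by
    rw [← Submodule.Quotient.mk_smul, op_smul_eq_mul, one_mul, eq_comm, Submodule.Quotient.eq]
    exact h1
  smul_eq_zero p := by
    obtain ⟨a, rfl⟩ := Submodule.Quotient.mk_surjective _ p
    rw [← Submodule.Quotient.mk_smul, op_smul_eq_mul, Submodule.Quotient.mk_eq_zero]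
    exact h2 a
  exists_smul p := by
    obtain ⟨a, rfl⟩ := Submodule.Quotient.mk_surjective _ p
    exact ⟨op a, by rw [← Submodule.Quotient.mk_smul, op_smul_eq_mul, one_mul]⟩
  exists_hom M _ _ hq m hm := by
    let φ : A →ₗ[Aᵐᵒᵖ] M :=
      { toFun := fun a => op a • m
        map_add' := fun a b => by rw [op_add, add_smul]
        map_smul' := fun r a => by
          rw [RingHom.id_apply, ← mul_smul, smul_eq_mul_unop, op_mul, op_unop] }
    have hφ : S ≤ LinearMap.ker φ := by
      apply h3
      · change op (1 - c) • m = 0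
        rw [op_sub, op_one, sub_smul, one_smul, hm, sub_self]
      · intro a
        change op (a * q) • m = 0
        rw [op_mul, mul_smul, hq]
    exact ⟨S.liftQ φ hφ, by
      rw [Submodule.liftQ_apply]
      change op (1 : A) • m = m
      rw [op_one, one_smul]⟩

theorem isRelProj_projMod (c : A) :
    IsRelProj 0 (op c) (projMod A c) (Submodule.Quotient.mk (1 : A)) := by
  refine isRelProj_quotMod (q := 0) (S := rSpan A {1 - c})
    (Submodule.subset_span (Set.mem_singleton _)) (fun a => ?_) fun S' h _ => ?_
  · rw [mul_zero]
    exact zero_mem _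
  · exact Submodule.span_le.2 (Set.singleton_subset_iff.2 h)

theorem isRelProj_cyclicQuot (c : A) :
    IsRelProj (1 - op c) (op c) (cyclicQuot A c) (Submodule.Quotient.mk (1 : A)) := by
  have hmem : ∀ a, a * (1 - c) ∈ tIdeal A (1 - c) := fun a => Submodule.subset_span ⟨a, rfl⟩
  refine isRelProj_quotMod (q := 1 - c) (S := tIdeal A (1 - c)) ?_ hmem fun S' _ h => ?_
  · simpa using hmem 1
  · refine Submodule.span_le.2 ?_
    rintro _ ⟨a, rfl⟩
    exact h a

end Quotient

/-- If `α : c → d` has a right inverse `β` and `d` is primitive, then `β` is a left inverse. -/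
theorem IsPrimIdem.mul_eq_of_mul_eq {A : Type} [Ring A] {c d α β : A} (hd : IsPrimIdem A d)
    (hc : c * c = c) (hc0 : c ≠ 0) (h1 : c * α = α) (h2 : α * d = α) (h3 : d * β = β)
    (hαβ : α * β = c) : β * α = d := by
  have hid : β * α * (β * α) = β * α := by
    rw [mul_assoc, ← mul_assoc α, hαβ, h1]
  have hne : β * α ≠ 0 := fun h => hc0 (by
    rw [← hc, ← hαβ, ← mul_assoc, mul_assoc α β α, h, mul_zero, zero_mul])
  have hr : β * α * d = β * α := by rw [mul_assoc, h2]
  have hl : d * (β * α) = β * α := by rw [← mul_assoc, h3]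
  rcases hd.2.2 (β * α) (d - β * α) hid (by
    change _ * _ = _
    rw [mul_sub, sub_mul, sub_mul, hd.1.eq, hr, hl, hid, sub_self, sub_zero])
    (by rw [mul_sub, hr, hid, sub_self])
    (by rw [sub_mul, hl, hid, sub_self]) (add_sub_cancel _ _) with h0 | h0
  · exact absurd h0 hne
  · exact (sub_eq_zero.1 h0).symm

theorem IsRelProj.nonempty_equiv {R : Type} [Ring R] {q c d : R} {P P' : Type} [AddCommGroup P]
    [Module R P] [AddCommGroup P'] [Module R P'] {u : P} {u' : P'} (hP : IsRelProj q c P u)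
    (hP' : IsRelProj q d P' u') {a b : R} (ha : c * a = a) (hb : d * b = b) (hab : a * b = c)
    (hba : b * a = d) : Nonempty (P ≃ₗ[R] P') := by
  obtain ⟨φ, hφ⟩ := hP.exists_hom P' hP'.smul_eq_zero (a • u') (by rw [← mul_smul, ha])
  obtain ⟨ψ, hψ⟩ := hP'.exists_hom P hP.smul_eq_zero (b • u) (by rw [← mul_smul, hb])
  refine ⟨LinearEquiv.ofLinearMap φ ψ (hP'.hom_ext ?_) (hP.hom_ext ?_)⟩
  · rw [LinearMap.comp_apply, hψ, map_smul, hφ, ← mul_smul, hba, hP'.smul_gen,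
      LinearMap.id_apply]
  · rw [LinearMap.comp_apply, hφ, map_smul, hψ, ← mul_smul, hab, hP.smul_gen,
      LinearMap.id_apply]

theorem IsBasicAlg.isNilpotent_corner (K : Type) [Field K] {A : Type} [Ring A] [Algebra K A]
    [FiniteDimensional K A] {ι : Type} [Fintype ι] {e : ι → A}
    (hb : IsBasicAlg A e) (hc : ∀ i, IsPrimIdem A (e i)) {i j : ι} (hij : i ≠ j) (x y : A) :
    IsNilpotent (e i * x * e j * y * e i) := by
  have hi : e i * e i = e i := (hc i).1
  have hj : e j * e j = e j := (hc j).1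
  rcases (hc i).isNilpotent_or K (x := e i * x * e j * y * e i)
    (by simp only [← mul_assoc, hi]) (by simp only [mul_assoc, hi]) with h | ⟨⟨z, hz⟩, -⟩
  · exact h
  exfalso
  have h1 : e i * (e i * z * e i * x * e j) = e i * z * e i * x * e j := by
    simp only [← mul_assoc, hi]
  have h2 : e j * (e j * y * e i) = e j * y * e i := by simp only [← mul_assoc, hj]
  have hαβ : (e i * z * e i * x * e j) * (e j * y * e i) = e i := by
    calc (e i * z * e i * x * e j) * (e j * y * e i)
        = e i * (z * (e i * x * (e j * e j) * y * e i)) := by simp only [mul_assoc]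
      _ = e i := by rw [hj, hz, hi]
  have hβα := (hc j).mul_eq_of_mul_eq hi (hc i).2.1 h1 (by simp only [mul_assoc, hj]) h2 hαβ
  obtain ⟨E⟩ := (isRelProj_projMod (e i)).nonempty_equiv (isRelProj_projMod (e j))
    (a := op (e j * y * e i)) (b := op (e i * z * e i * x * e j))
    (by rw [← op_mul, mul_assoc, hi]) (by rw [← op_mul, mul_assoc, hj])
    (by rw [← op_mul, hαβ]) (by rw [← op_mul, hβα])
  exact (hb i j hij).false E

theorem isNilpotent_op {A : Type} [Ring A] {x : A} : IsNilpotent (op x) ↔ IsNilpotent x := by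
  simp [IsNilpotent, ← op_pow]

theorem CompletePrimIdems.basicIdems (K : Type) [Field K] {A : Type} [Ring A] [Algebra K A]
    [FiniteDimensional K A] {ι : Type} [Fintype ι] {e : ι → A}
    (hc : CompletePrimIdems A e) (hb : IsBasicAlg A e) : BasicIdems fun i => op (e i) where
  idem i := by rw [← op_mul, (hc.1 i).1.eq]
  orth i j hij := by rw [← op_mul, hc.2.1 hij.symm, op_zero]
  sum_eq_one := by rw [← Finset.op_sum, hc.2.2, op_one]
  ne_zero i := (op_ne_zero_iff _).2 (hc.1 i).2.1
  isNilpotent_or i x h1 h2 := by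
    induction x with | _ x
    rw [← op_mul, op_inj] at h1 h2
    refine ((hc.1 i).isNilpotent_or K h2 h1).imp isNilpotent_op.2 fun ⟨_, y, hy⟩ => ?_
    exact ⟨op y, by rw [← op_mul, hy]⟩
  isNilpotent_of_ne i j hij x y := by
    induction x with | _ x
    induction y with | _ y
    simp only [← op_mul, isNilpotent_op, ← mul_assoc]
    exact hb.isNilpotent_corner K hc.1 hij y x

section Radical

variable {K : Type} [Field K] {A : Type} [Ring A] [Algebra K A]

theorem mem_radK {x : A} : x ∈ radK K A ↔ x ∈ Ring.jacobson A := by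
  rw [Ring.jacobson_eq_sInf_isMaximal, radK, Submodule.restrictScalars_mem]

theorem mul_mem_radK_left (a : A) {x : A} (hx : x ∈ radK K A) : a * x ∈ radK K A :=
  mem_radK.2 (Ideal.mul_mem_left _ a (mem_radK.1 hx))

theorem mul_mem_radK_right {x : A} (hx : x ∈ radK K A) (a : A) : x * a ∈ radK K A :=
  mem_radK.2 (Ideal.mul_mem_right a _ (mem_radK.1 hx))

theorem exists_radK_pow_eq_bot (K : Type) [Field K] (A : Type) [Ring A] [Algebra K A]
    [FiniteDimensional K A] : ∃ n, radK K A ^ n = ⊥ := by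
  have : IsArtinianRing A := IsArtinianRing.of_finite K A
  obtain ⟨n, hn⟩ := IsArtinianRing.isNilpotent_jacobson_bot (R := A)
  rw [Ideal.jacobson_bot] at hn
  have h : ∀ n, radK K A ^ n ≤ (Ring.jacobson A ^ n).restrictScalars K := by
    intro n
    induction n with
    | zero => exact fun x _ => by rw [Submodule.pow_zero, Ideal.one_eq_top]; trivial
    | succ n ih =>
      rw [pow_succ]
      refine Submodule.mul_le.2 fun x hx y hy => ?_
      rw [Submodule.restrictScalars_mem, Submodule.pow_succ]
      exact Submodule.mul_mem_mul (ih hx) (mem_radK.1 hy)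
  refine ⟨n, eq_bot_iff.2 fun x hx => ?_⟩
  have := h n hx
  rwa [hn] at this

variable {ι : Type} [Fintype ι] {e : ι → A}

theorem CompletePrimIdems.corner_mem_radK [FiniteDimensional K A] (hc : CompletePrimIdems A e)
    (hb : IsBasicAlg A e) {i j : ι} (hij : i ≠ j) (x : A) : e i * x * e j ∈ radK K A := by
  have hj : e j * e j = e j := (hc.1 j).1
  rw [mem_radK, ← Ideal.jacobson_bot, Ideal.mem_jacobson_iff]
  intro y
  obtain ⟨n, hn⟩ := hb.isNilpotent_corner K hc.1 hij.symm y x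
  have hsemi : SemiconjBy (e j) (y * (e i * x * e j)) (e j * y * e i * x * e j) := by
    simp only [SemiconjBy, mul_assoc, hj]
  have hnil : IsNilpotent (y * (e i * x * e j)) := by
    refine ⟨n + 1, ?_⟩
    have h := (hsemi.pow_right n).eq
    rw [hn, zero_mul] at h
    rw [pow_succ']
    simp only [mul_assoc] at h ⊢
    rw [h]
    simp only [mul_zero]
  obtain ⟨z, hz⟩ := hnil.isUnit_one_add.exists_left_inv
  refine ⟨z, ?_⟩
  rw [mul_add, mul_one] at hz
  rw [mul_assoc, add_comm, hz, sub_self]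
  exact zero_mem _

theorem CompletePrimIdems.one_sub_sub_eq_sum [DecidableEq ι] (hc : CompletePrimIdems A e)
    {i j : ι} (hij : i ≠ j) : 1 - e i - e j = ∑ k ∈ Finset.univ \ {i, j}, e k := by
  rw [Finset.sum_sdiff_eq_sub (Finset.subset_univ _), hc.2.2, Finset.sum_pair hij, sub_sub]

end Radical

section Arrows

variable {K : Type} [Field K] {A : Type} [Ring A] [Algebra K A]
  {ι : Type} [Fintype ι] [DecidableEq ι] {e : ι → A}
  {Arr : ι → ι → Type} [∀ i j, Fintype (Arr i j)] {arr : ∀ i j, Arr i j → A}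

/-- The largest right ideal all of whose `(i, j)`-components lie in the square of the radical. -/
def cornerIdeal (K : Type) [Field K] {A : Type} [Ring A] [Algebra K A] (c d : A) :
    Submodule Aᵐᵒᵖ A where
  carrier := {a | ∀ b, c * (a * b) * d ∈ radK K A * radK K A}
  zero_mem' b := by simp
  add_mem' ha hb b := by
    rw [add_mul, mul_add, add_mul]
    exact add_mem (ha b) (hb b)
  smul_mem' r a ha b := by
    rw [smul_eq_mul_unop, mul_assoc a]
    exact ha _

theorem CompletePrimIdems.mul_one_sub_sub_mem_cornerIdeal [FiniteDimensional K A]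
    (hc : CompletePrimIdems A e) (hb : IsBasicAlg A e) {i j : ι} (hij : i ≠ j) (a : A) :
    a * (1 - e i - e j) ∈ cornerIdeal K (e i) (e j) := by
  intro b
  rw [hc.one_sub_sub_eq_sum hij]
  simp only [Finset.mul_sum, Finset.sum_mul]
  refine sum_mem fun k hk => ?_
  simp only [Finset.mem_sdiff, Finset.mem_univ, true_and, Finset.mem_insert,
    Finset.mem_singleton, not_or] at hk
  have h : e i * (a * e k * b) * e j = e i * a * e k * (e k * b * e j) := by
    conv_lhs => rw [← (hc.1 k).1.eq]
    simp only [mul_assoc]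
  rw [h]
  exact Submodule.mul_mem_mul (hc.corner_mem_radK hb (Ne.symm hk.1) a)
    (hc.corner_mem_radK hb hk.2 b)

theorem IsGabrielPres.arr_notMem (h : IsGabrielPres A K e Arr arr) {i j : ι} (a : Arr i j) :
    arr i j a ∉ radK K A * radK K A := by
  classical
  intro ha
  have := h.2.2.2.2 (Pi.single ⟨i, j, a⟩ 1) (by
    rw [Finset.sum_eq_single ⟨i, j, a⟩ (fun p _ hp => by rw [Pi.single_eq_of_ne hp, zero_smul])
      (fun h => absurd (Finset.mem_univ _) h), Pi.single_eq_same, one_smul]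
    exact ha) ⟨i, j, a⟩
  rw [Pi.single_eq_same] at this
  exact one_ne_zero this

/-- Elements of `A` annihilating the right module `M`. -/
def annK (K : Type) [Field K] {A : Type} [Ring A] [Algebra K A] (M : Type) [AddCommGroup M]
    [Module Aᵐᵒᵖ M] : Submodule K A where
  carrier := {a | ∀ m : M, op a • m = 0}
  zero_mem' m := by rw [op_zero, zero_smul]
  add_mem' ha hb m := by rw [op_add, add_smul, ha, hb, add_zero]
  smul_mem' c a ha m := by
    rw [Algebra.smul_def, op_mul, mul_smul]
    exact ha _

theorem mul_mem_annK_left {M : Type} [AddCommGroup M] [Module Aᵐᵒᵖ M] (b : A) {a : A}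
    (ha : a ∈ annK K M) : b * a ∈ annK K M := fun m => by
  rw [op_mul, mul_smul]
  exact ha _

theorem mul_mem_annK_right {M : Type} [AddCommGroup M] [Module Aᵐᵒᵖ M] {a : A}
    (ha : a ∈ annK K M) (b : A) : a * b ∈ annK K M := fun m => by
  rw [op_mul, mul_smul, ha m, smul_zero]

/-- If there is no arrow `i → j`, then modulo every module supported on `{i, j}` the space
`e i (rad A) e j` lies in arbitrarily high powers of the radical. -/
theorem IsGabrielPres.corner_mem_sup (h : IsGabrielPres A K e Arr arr) {i j : ι}
    (hA : IsEmpty (Arr i j)) {M : Type} [AddCommGroup M] [Module Aᵐᵒᵖ M]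
    (hM : 1 - e i - e j ∈ annK K M) (n : ℕ) {x : A} (hx : x ∈ radK K A) :
    e i * x * e j ∈ radK K A ^ (n + 1) ⊔ annK K M := by
  induction n generalizing x with
  | zero =>
    rw [zero_add, pow_one]
    exact Submodule.mem_sup_left (mul_mem_radK_right (mul_mem_radK_left _ hx) _)
  | succ n ih =>
    let φ : A →ₗ[K] A := LinearMap.mulRight K (e j) ∘ₗ LinearMap.mulLeft K (e i)
    suffices hle : radK K A ≤ (radK K A ^ (n + 1 + 1) ⊔ annK K M).comap φ from hle hx
    refine h.2.2.2.1.trans (sup_le (Submodule.span_le.2 ?_) (Submodule.mul_le.2 ?_))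
    · rintro _ ⟨⟨k, l, a⟩, rfl⟩
      change e i * arr k l a * e j ∈ radK K A ^ (n + 1 + 1) ⊔ annK K M
      have h0 : e i * arr k l a * e j = 0 := by
        rw [← (h.2.2.1 k l a).2]
        by_cases hk : i = k
        · by_cases hl : l = j
          · subst hk hl
            exact hA.elim a
          · rw [mul_assoc, mul_assoc (e k * _), h.1.2.1 hl, mul_zero, mul_zero]
        · rw [← mul_assoc, ← mul_assoc, h.1.2.1 hk, zero_mul, zero_mul, zero_mul]
      rw [h0]
      exact zero_mem _
    · intro x hx y hy
      change e i * (x * y) * e j ∈ radK K A ^ (n + 1 + 1) ⊔ annK K M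
      have hxy : e i * (x * y) * e j = e i * x * e i * (e i * y * e j) +
          e i * x * e j * (e j * y * e j) + e i * x * (1 - e i - e j) * (y * e j) := by
        have hs : x * y = x * (e i * e i + e j * e j + (1 - e i - e j)) * y := by
          rw [(h.1.1 i).1.eq, (h.1.1 j).1.eq, sub_sub, add_sub_cancel, mul_one]
        rw [hs]
        noncomm_ring
      rw [hxy]
      refine add_mem (add_mem ?_ ?_) (Submodule.mem_sup_right (mul_mem_annK_right
        (mul_mem_annK_left _ hM) _))
      · obtain ⟨u, hu, v, hv, huv⟩ := Submodule.mem_sup.1 (ih hy)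
        rw [← huv, mul_add, pow_succ']
        exact add_mem (Submodule.mem_sup_left (Submodule.mul_mem_mul
          (mul_mem_radK_right (mul_mem_radK_left _ hx) _) hu))
          (Submodule.mem_sup_right (mul_mem_annK_left _ hv))
      · obtain ⟨u, hu, v, hv, huv⟩ := Submodule.mem_sup.1 (ih hx)
        rw [← huv, add_mul, pow_succ]
        exact add_mem (Submodule.mem_sup_left (Submodule.mul_mem_mul hu
          (mul_mem_radK_right (mul_mem_radK_left _ hy) _)))
          (Submodule.mem_sup_right (mul_mem_annK_right hv _))

/-- The arrows of the Gabriel quiver are detected by the poset of support τ-tilting modules. -/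
theorem IsGabrielPres.nonempty_arr_iff [FiniteDimensional K A] (h : IsGabrielPres A K e Arr arr)
    {i j : ι} (hij : i ≠ j) :
    Nonempty (Arr i j) ↔ HasLink (IsBSTT A e) (cyclicQuot A (e i)) (cyclicQuot A (e j)) := by
  have H := h.1.basicIdems K h.2.1
  have hPA : IsBSTT A e = IsBasicSTT fun i => op (e i) := funext fun M => propext isBSTT_iff
  have : IsArtinianRing Aᵐᵒᵖ := IsArtinianRing.of_finite K Aᵐᵒᵖ
  rw [hPA]
  constructor
  · rintro ⟨a⟩
    refine H.hasLink_of_smul_ne_zero hij (isRelProj_cyclicQuot (e i)) (isRelProj_cyclicQuot (e j)) K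
      (M := A ⧸ cornerIdeal K (e i) (e j)) (m := Submodule.Quotient.mk 1) (r := op (arr i j a))
      (fun m => ?_) ?_
    · obtain ⟨b, rfl⟩ := Submodule.Quotient.mk_surjective _ m
      rw [← Submodule.Quotient.mk_smul, Submodule.Quotient.mk_eq_zero]
      exact h.1.mul_one_sub_sub_mem_cornerIdeal h.2.1 hij b
    · simp only [← Submodule.Quotient.mk_smul, op_smul_eq_mul, one_mul]
      rw [(h.2.2.1 i j a).2, Ne, Submodule.Quotient.mk_eq_zero]
      intro ha
      refine h.arr_notMem a ?_
      have := ha 1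
      rwa [mul_one, (h.2.2.1 i j a).2] at this
  · intro hl
    obtain ⟨M, hM, r, m, hr⟩ := H.exists_smul_ne_zero_of_hasLink hij (isRelProj_cyclicQuot (e i))
      (isRelProj_cyclicQuot (e j)) hl
    by_contra hA
    rw [not_nonempty_iff] at hA
    obtain ⟨n, hn⟩ := exists_radK_pow_eq_bot K A
    have hx := h.corner_mem_sup hA (M := M) hM n
      (h.1.corner_mem_radK (K := K) h.2.1 hij (unop r))
    rw [pow_succ, hn, Submodule.bot_mul, bot_sup_eq] at hx
    refine hr ?_
    have h0 := hx m
    simp only [op_mul, mul_smul, op_unop] at h0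
    rwa [H.smul_smul j, H.smul_smul i] at h0

end Arrows

theorem PE.symm {R : Type} [Ring R] {M N : Mdl R} (h : PE M N) : PE N M := ⟨h.2, h.1⟩

section Transport

variable {R S : Type} [Ring R] [Ring S] {PA : Mdl R → Prop} {PB : Mdl S → Prop}

/-- The inverse of an isomorphism of posets. -/
def PosetIsoP.symm (ρ : PosetIsoP PA PB) : PosetIsoP PB PA where
  toFun := ρ.invFun
  invFun := ρ.toFun
  maps := ρ.maps'
  maps' := ρ.maps
  le_iff := ρ.le_iff'
  le_iff' := ρ.le_iff
  left_inv := ρ.right_inv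
  right_inv := ρ.left_inv

theorem PosetIsoP.facLE_toFun_iff (ρ : PosetIsoP PA PB) {M : Mdl R} {N : Mdl S} (hM : PA M)
    (hN : PB N) : FacLE (ρ.toFun M) N ↔ FacLE M (ρ.invFun N) := by
  rw [ρ.le_iff M _ hM (ρ.maps' N hN)]
  exact ⟨fun h => h.trans (ρ.right_inv N hN).2, fun h => h.trans (ρ.right_inv N hN).1⟩

theorem PosetIsoP.facLT_iff (ρ : PosetIsoP PA PB) {M N : Mdl R} (hM : PA M) (hN : PA N) :
    FacLT M N ↔ FacLT (ρ.toFun M) (ρ.toFun N) :=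
  and_congr (ρ.le_iff M N hM hN) (not_congr (ρ.le_iff N M hN hM))

theorem HasLink.map (ρ : PosetIsoP PA PB) {M N : Mdl R} {M' N' : Mdl S} (hM : PA M) (hN : PA N)
    (hMM' : PE (ρ.toFun M) M') (hNN' : PE (ρ.toFun N) N') (h : HasLink PA M N) :
    HasLink PB M' N' := by
  obtain ⟨C, J, hC, hJ, hMJ, hNJ, hmin, hMC, hCJ⟩ := h
  refine ⟨ρ.toFun C, ρ.toFun J, ρ.maps C hC, ρ.maps J hJ,
    hMM'.2.trans ((ρ.le_iff M J hM hJ).1 hMJ), hNN'.2.trans ((ρ.le_iff N J hN hJ).1 hNJ),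
    fun T hT hMT hNT => (ρ.facLE_toFun_iff hJ hT).2 (hmin _ (ρ.maps' T hT)
      ((ρ.facLE_toFun_iff hM hT).1 (hMM'.1.trans hMT))
      ((ρ.facLE_toFun_iff hN hT).1 (hNN'.1.trans hNT))), ?_, (ρ.facLT_iff hC hJ).1 hCJ⟩
  obtain ⟨h1, h2⟩ := (ρ.facLT_iff hM hC).1 hMC
  exact ⟨hMM'.2.trans h1, fun h => h2 (h.trans hMM'.2)⟩

theorem PosetIsoP.symm_pe (ρ : PosetIsoP PA PB) {M : Mdl R} {N : Mdl S} (hM : PA M) (hN : PB N)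
    (h : PE (ρ.toFun M) N) : PE (ρ.symm.toFun N) M :=
  ⟨(ρ.symm.facLE_toFun_iff hN hM).2 h.2, (ρ.facLE_toFun_iff hM hN).1 h.1⟩

end Transport

namespace CompletePrimIdems

variable (K : Type) [Field K] {A : Type} [Ring A] [Algebra K A] [FiniteDimensional K A]
  {ι : Type} [Fintype ι] {e : ι → A} (hc : CompletePrimIdems A e) (hb : IsBasicAlg A e)

include K hc hb

theorem isBSTT_cyclicQuot (i : ι) : IsBSTT A e (cyclicQuot A (e i)) :=
  isBSTT_iff.2 ((hc.basicIdems K hb).isBasicSTT_simple (isRelProj_cyclicQuot (e i)))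

theorem facLE_cyclicQuot_iff (i : ι) {T : Mdl Aᵐᵒᵖ} (hT : IsBSTT A e T) :
    FacLE (cyclicQuot A (e i)) T ↔ HasTop (fun k => op (e k)) T i := by
  have : IsArtinianRing Aᵐᵒᵖ := IsArtinianRing.of_finite K Aᵐᵒᵖ
  exact (hc.basicIdems K hb).facLE_simple_iff (isRelProj_cyclicQuot (e i)) hT.1.2.1

theorem eq_of_facLE_cyclicQuot {i j : ι}
    (h : FacLE (cyclicQuot A (e i)) (cyclicQuot A (e j))) : i = j := by
  by_contra hij
  exact (hc.basicIdems K hb).not_hasTop_relProj (isRelProj_cyclicQuot (e j)) (Ne.symm hij)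
    ((hc.facLE_cyclicQuot_iff K hb i (hc.isBSTT_cyclicQuot K hb j)).1 h)

theorem exists_facLE_cyclicQuot {T : Mdl Aᵐᵒᵖ} (hT : IsBSTT A e T) [Nontrivial T] :
    ∃ i, FacLE (cyclicQuot A (e i)) T := by
  have := hT.1.1
  obtain ⟨i, hi, -⟩ := (hc.basicIdems K hb).hasTop_of_nontrivial (M := T) (memFac_self T)
  exact ⟨i, (hc.facLE_cyclicQuot_iff K hb i hT).2 hi⟩

theorem nontrivial_cyclicQuot (i : ι) : Nontrivial (cyclicQuot A (e i)) :=
  have H := hc.basicIdems K hb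
  ⟨⟨_, 0, H.gen_ne_zero (isRelProj_cyclicQuot (e i)) (H.one_sub_mul i)⟩⟩

end CompletePrimIdems

end TauTilting

open TauTilting in
/-- If `ρ : sτtilt Λ → sτtilt Γ` is a poset isomorphism with
induced map `σ : Q₀ → Q'₀` (defined by `ρ(X_i) = X_{σ(i)}`), then `σ` extends to
a quiver isomorphism `Q* ≅ (Q')*`: `σ` is a bijection and, for `i ≠ j`, there is
an arrow `i → j` in `Q°` iff there is an arrow `σ(i) → σ(j)` in `(Q')°`. -/
theorem statement6
    (K : Type) [Field K]
    (Λ : Type) [Ring Λ] [Algebra K Λ] [FiniteDimensional K Λ]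
    (ι : Type) [Fintype ι] [DecidableEq ι] (e : ι → Λ)
    (Arr : ι → ι → Type) [∀ i j, Fintype (Arr i j)] (arr : ∀ i j, Arr i j → Λ)
    (hpres : IsGabrielPres Λ K e Arr arr)
    (Γ : Type) [Ring Γ] [Algebra K Γ] [FiniteDimensional K Γ]
    (ι' : Type) [Fintype ι'] [DecidableEq ι'] (f : ι' → Γ)
    (Arr' : ι' → ι' → Type) [∀ i j, Fintype (Arr' i j)] (arr' : ∀ i j, Arr' i j → Γ)
    (hpres' : IsGabrielPres Γ K f Arr' arr')
    (ρ : PosetIsoP (IsBSTT Λ e) (IsBSTT Γ f))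
    (σ : ι → ι')
    (hσ : ∀ i, PE (ρ.toFun (cyclicQuot Λ (e i))) (cyclicQuot Γ (f (σ i)))) :
    Function.Bijective σ ∧
    ∀ i j : ι, i ≠ j → (Nonempty (Arr i j) ↔ Nonempty (Arr' (σ i) (σ j))) := by
  have hX := hpres.1.isBSTT_cyclicQuot K hpres.2.1
  have hX' := hpres'.1.isBSTT_cyclicQuot K hpres'.2.1
  have hinj : Function.Injective σ := fun i j hij =>
    hpres.1.eq_of_facLE_cyclicQuot K hpres.2.1 ((ρ.le_iff _ _ (hX i) (hX j)).2
      ((hσ i).1.trans (hij ▸ (hσ j).2)))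
  refine ⟨⟨hinj, fun k => ?_⟩, fun i j hij => ?_⟩
  · have hT := ρ.maps' _ (hX' k)
    have : Nontrivial (ρ.invFun (cyclicQuot Γ (f k))) := by
      by_contra hT0
      rw [not_nontrivial_iff_subsingleton] at hT0
      let Z : Mdl Γᵐᵒᵖ := ModuleCat.of Γᵐᵒᵖ PUnit
      have hZ : IsBSTT Γ f Z := isBSTT_iff.2 (isBasicSTT_of_subsingleton _ PUnit)
      have h : FacLE (cyclicQuot Γ (f k)) Z := (ρ.le_iff' _ _ (hX' k) hZ).2
        (facLE_iff.2 (memFac_of_subsingleton _ _))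
      have := hpres'.1.nontrivial_cyclicQuot K hpres'.2.1 k
      obtain ⟨x, hx⟩ := exists_ne (0 : cyclicQuot Γ (f k))
      refine hx ?_
      have h1 := (facLE_iff.1 h).smul_eq_zero (r := 1) (fun m => Subsingleton.elim _ _) x
      rwa [one_smul] at h1
    obtain ⟨i, hi⟩ := hpres.1.exists_facLE_cyclicQuot K hpres.2.1 hT
    exact ⟨i, hpres'.1.eq_of_facLE_cyclicQuot K hpres'.2.1
      ((hσ i).2.trans ((ρ.facLE_toFun_iff (hX i) (hX' k)).2 hi))⟩
  · rw [hpres.nonempty_arr_iff hij, hpres'.nonempty_arr_iff (hinj.ne hij)]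
    exact ⟨fun h => h.map ρ (hX i) (hX j) (hσ i) (hσ j), fun h => h.map ρ.symm (hX' _) (hX' _)
      (ρ.symm_pe (hX i) (hX' _) (hσ i)) (ρ.symm_pe (hX j) (hX' _) (hσ j))⟩
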